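/- arXiv:2103.08416 — 4 statements merged into one kernel-verified Lean document; each statement's English description precedes it below -/
import Mathlib

section
/- There do not exist points u, v, a₁, a₂, a₃, a₄, b₁, b₂, b₃, b₄ in the Euclidean plane ℝ² such that dist(u, v) ≤ 2, dist(u, aᵢ) ≤ 2 for all 1 ≤ i ≤ 4, dist(v, bⱼ) ≤ 2 for all 1 ≤ j ≤ 4, and every other pair of these ten points is at distance strictly greater than 2; that is, dist(aᵢ, aⱼ) > 2 and dist(bᵢ, bⱼ) > 2 for all i ≠ j, dist(aᵢ, bⱼ) > 2 for all i, j, dist(v, aᵢ) > 2 for all i, and dist(u, bⱼ) > 2 for all j. Equivalently, the double star obtained from an edge uv by attaching four pendant leaves to each of u and v is not a unit disk graph. -/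
open Real

lemma cos_le_neg_cos_of_abs_sub_pi_le {q t : ℝ} (hq : q ≤ π) (h : |t - π| ≤ q) :
    cos q ≤ -cos t := by
  rw [← cos_sub_pi, ← cos_abs (t - π)]
  exact cos_le_cos_of_nonneg_of_le_pi (abs_nonneg _) hq h

lemma sin_add_le_sin_add_sin {x y : ℝ} (hx : 0 ≤ sin x) (hy : 0 ≤ sin y) :
    sin (x + y) ≤ sin x + sin y := by
  rw [sin_add]
  nlinarith [cos_le_one x, cos_le_one y]

lemma sin_add_mul_cos_add (p x y : ℝ) :
    sin (x + y) * cos (p + x) = sin y * cos p + sin x * cos (p + x + y) := by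
  simp only [sin_add, cos_add]
  linear_combination (cos p * sin y) * sin_sq_add_cos_sq x

/-- The case `α = p` of `quadrilateral_cos_ineq`. -/
lemma quadrilateral_cos_ineq_endpoint {p q β : ℝ} (hp : π / 3 ≤ p) (hq : π / 3 ≤ q)
    (hq' : q ≤ π / 2) (hβ : q ≤ β) (h : 2 * p + β + q ≤ 5 * π / 3) :
    cos p ^ 2 + cos q ^ 2 + 2 * cos p * cos q * cos (p + β) ≤
      cos p * cos p + cos q * cos β := by
  have hpi := pi_pos
  have h0 : 0 ≤ cos q := cos_nonneg_of_mem_Icc ⟨by linarith, hq'⟩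
  have h1 : cos q ≤ -cos (2 * p + β) :=
    cos_le_neg_cos_of_abs_sub_pi_le (by linarith) (abs_le.2 ⟨by linarith, by linarith⟩)
  have h2 : 2 * cos p * cos (p + β) = cos (2 * p + β) + cos β := by
    rw [show 2 * p + β = p + (p + β) by ring, show cos β = cos ((p + β) - p) by ring_nf,
      cos_add p (p + β), cos_sub]
    ring
  have h3 : 2 * cos p * cos q * cos (p + β) = cos q * (cos (2 * p + β) + cos β) := by
    rw [← h2]; ring
  rw [h3]
  nlinarith

lemma quadrilateral_cos_ineq {p q α β : ℝ} (hp : π / 3 ≤ p) (hp' : p ≤ π / 2)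
    (hq : π / 3 ≤ q) (hq' : q ≤ π / 2) (hα : p ≤ α) (hβ : q ≤ β)
    (h : α + β + p + q ≤ 5 * π / 3) :
    cos p ^ 2 + cos q ^ 2 + 2 * cos p * cos q * cos (α + β) ≤
      cos p * cos α + cos q * cos β := by
  have hpi := pi_pos
  obtain ⟨x, rfl⟩ : ∃ x, α = p + x := ⟨α - p, by ring⟩
  obtain ⟨y, rfl⟩ : ∃ y, β = q + y := ⟨β - q, by ring⟩
  have hx : 0 ≤ x := by linarith
  have hy : 0 ≤ y := by linarith
  have e1 := quadrilateral_cos_ineq_endpoint (β := q + y + x) hp hq hq' (by linarith) (by linarith)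
  have e2 := quadrilateral_cos_ineq_endpoint (β := p + x + y) hq hp hp' (by linarith) (by linarith)
  rw [show p + (q + y + x) = p + x + (q + y) by ring] at e1
  rw [show q + (p + x + y) = p + x + (q + y) by ring] at e2
  have hcp : 0 ≤ cos p := cos_nonneg_of_mem_Icc ⟨by linarith, hp'⟩
  have hcq : 0 ≤ cos q := cos_nonneg_of_mem_Icc ⟨by linarith, hq'⟩
  have hsx : 0 ≤ sin x := sin_nonneg_of_nonneg_of_le_pi hx (by linarith)
  have hsy : 0 ≤ sin y := sin_nonneg_of_nonneg_of_le_pi hy (by linarith)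
  set K := cos p ^ 2 + cos q ^ 2 + 2 * cos p * cos q * cos (p + x + (q + y)) with hK
  have hK0 : 0 ≤ K := by
    nlinarith [neg_one_le_cos (p + x + (q + y)), mul_nonneg hcp hcq, sq_nonneg (cos p - cos q)]
  rcases (add_nonneg hx hy).eq_or_lt with h0 | h0
  · obtain rfl : x = 0 := by linarith
    obtain rfl : y = 0 := by linarith
    simp only [add_zero] at e1 ⊢
    linarith
  have hs : 0 < sin (x + y) := sin_pos_of_pos_of_lt_pi h0 (by linarith)
  have i1 := sin_add_mul_cos_add p x y
  have i2 := sin_add_mul_cos_add q y x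
  rw [add_comm y x] at i2
  have key : sin (x + y) * (cos p * cos (p + x) + cos q * cos (q + y)) =
      sin y * (cos p * cos p + cos q * cos (q + y + x)) +
        sin x * (cos q * cos q + cos p * cos (p + x + y)) := by
    linear_combination cos p * i1 + cos q * i2
  refine le_of_mul_le_mul_left ?_ hs
  rw [key]
  have := mul_le_mul_of_nonneg_right (sin_add_le_sin_add_sin hsx hsy) hK0
  have := mul_le_mul_of_nonneg_left e1 hsy
  have e2' : K ≤ cos q * cos q + cos p * cos (p + x + y) := by rw [hK]; linarith
  have := mul_le_mul_of_nonneg_left e2' hsx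
  linarith

lemma pi_div_three_le_arccos {r : ℝ} (hr : r ≤ 2) : π / 3 ≤ arccos (r / 4) := by
  have : arccos (1 / 2) = π / 3 := by
    rw [← cos_pi_div_three, arccos_cos] <;> linarith [pi_pos]
  rw [← this]
  exact arccos_le_arccos (by linarith)

/-- In a quadrilateral `a u v b` with `|uv| = d`, `|ua| = r`, `|vb| = s` at most `2` and with
`|ab| > 2`, the angles `α` at `u` and `β` at `v` cannot both be small. -/
lemma quadrilateral_angles {r s d α β : ℝ} (hr : 0 < r) (hr' : r ≤ 2) (hs : 0 < s) (hs' : s ≤ 2)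
    (hd' : d ≤ 2) (hα : arccos (r / 4) ≤ α) (hβ : arccos (s / 4) ≤ β)
    (hrd : 2 * r * cos α ≤ d) (hsd : 2 * s * cos β ≤ d)
    (h : 4 < d ^ 2 + r ^ 2 + s ^ 2 - 2 * d * r * cos α - 2 * d * s * cos β
      + 2 * r * s * cos (α + β)) :
    5 * π / 3 < α + β + arccos (r / 4) + arccos (s / 4) := by
  by_contra! hc
  have := quadrilateral_cos_ineq (pi_div_three_le_arccos hr')
    (arccos_le_pi_div_two.2 (by positivity)) (pi_div_three_le_arccos hs')
    (arccos_le_pi_div_two.2 (by positivity)) hα hβ hc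
  rw [cos_arccos (by linarith) (by linarith), cos_arccos (by linarith) (by linarith)] at this
  nlinarith [mul_nonneg (sub_nonneg.2 hd')
    (show 0 ≤ 2 + d - 2 * (r * cos α + s * cos β) by linarith)]

/-- The angle at `o` between two points within distance `2` of `o` that are more than `2` apart. -/
lemma arccos_lt_angle {r s x : ℝ} (hr : 0 < r) (hr' : r ≤ 2) (hs : 0 < s) (hs' : s ≤ 2)
    (h : 4 < r ^ 2 + s ^ 2 - 2 * r * s * cos x) (hx : 0 ≤ x) (hx' : x ≤ 2 * π) :
    arccos (r / 4) < x ∧ x < 2 * π - arccos (r / 4) := by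
  have hc : cos x < r / 4 := by
    by_contra! hc
    nlinarith [mul_le_mul_of_nonneg_left hc (mul_pos hr hs).le,
      mul_nonneg (sub_nonneg.2 hs') (show 0 ≤ 2 + s - r ^ 2 / 2 by nlinarith)]
  have hcos : cos (arccos (r / 4)) = r / 4 := cos_arccos (by linarith) (by linarith)
  constructor <;> by_contra! hc'
  · linarith [cos_le_cos_of_nonneg_of_le_pi hx (arccos_le_pi _) hc']
  · have := cos_le_cos_of_nonneg_of_le_pi (x := 2 * π - x) (by linarith) (arccos_le_pi (r / 4))
      (by linarith)
    rw [cos_two_pi_sub] at this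
    linarith

/-- Around a star center with neighbors in polar coordinates `(d, 0)` and `(r i, θ i)`, the two
leaves next to the neighbor `(d, 0)` satisfy an angle-sum bound. -/
lemma star_angles {d : ℝ} {r θ : Fin 4 → ℝ} (hd : 0 < d) (hd' : d ≤ 2)
    (hr : ∀ i, 0 < r i) (hr' : ∀ i, r i ≤ 2) (hθ : ∀ i, 0 ≤ θ i) (hθ' : ∀ i, θ i ≤ 2 * π)
    (h : ∀ i j, i ≠ j → 4 < r i ^ 2 + r j ^ 2 - 2 * r i * r j * cos (θ i - θ j))
    (hv : ∀ i, 4 < r i ^ 2 + d ^ 2 - 2 * r i * d * cos (θ i)) :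
    ∃ i j, arccos (r i / 4) ≤ θ i ∧ arccos (r j / 4) ≤ 2 * π - θ j ∧
      θ i + arccos (r i / 4) + (2 * π - θ j) + arccos (r j / 4) < 5 * π / 3 := by
  set σ := Tuple.sort θ
  have hmono : Monotone (θ ∘ σ) := Tuple.monotone_sort θ
  have gap : ∀ i j : Fin 4, i < j → arccos (r (σ i) / 4) < θ (σ j) - θ (σ i) ∧
      arccos (r (σ j) / 4) < θ (σ j) - θ (σ i) := by
    intro i j hij
    have hne : σ j ≠ σ i := fun e => hij.ne' (σ.injective e)
    have hle : θ (σ i) ≤ θ (σ j) := hmono hij.le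
    have h1 := h _ _ hne
    constructor
    · refine (arccos_lt_angle (hr _) (hr' _) (hr (σ j)) (hr' _) ?_ (by linarith)
        (by linarith [hθ (σ i), hθ' (σ j)])).1
      linarith
    · exact (arccos_lt_angle (hr _) (hr' _) (hr (σ i)) (hr' _) h1 (by linarith)
        (by linarith [hθ (σ i), hθ' (σ j)])).1
  have g := fun i => arccos_lt_angle (hr i) (hr' i) hd hd' (hv i) (hθ i) (hθ' i)
  refine ⟨σ 0, σ 3, (g _).1.le, by linarith [(g (σ 3)).2], ?_⟩
  linarith [(gap 0 1 (by decide)).1, (gap 1 2 (by decide)).1, (gap 2 3 (by decide)).2,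
    pi_div_three_le_arccos (hr' (σ 1))]

lemma two_mul_mul_cos_le {r d x : ℝ} (hr : 0 < r) (hr' : r ≤ 2) (hd : 0 < d)
    (h : 4 < r ^ 2 + d ^ 2 - 2 * r * d * cos x) : 2 * r * cos x ≤ d := by
  by_contra! hc
  nlinarith

lemma exists_polar (x y τ : ℝ) :
    ∃ r θ, 0 ≤ r ∧ 0 ≤ θ ∧ θ ≤ 2 * π ∧ x = r * cos (τ + θ) ∧ y = r * sin (τ + θ) := by
  set z : ℂ := ⟨x, y⟩
  have hm := toIcoMod_mem_Ico two_pi_pos 0 (z.arg - τ)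
  have e : τ + toIcoMod two_pi_pos 0 (z.arg - τ) =
      z.arg - toIcoDiv two_pi_pos 0 (z.arg - τ) * (2 * π) := by
    rw [toIcoMod, zsmul_eq_mul]; ring
  refine ⟨‖z‖, toIcoMod two_pi_pos 0 (z.arg - τ), norm_nonneg _, hm.1, by linarith [hm.2], ?_, ?_⟩
  · rw [e, cos_sub_int_mul_two_pi, Complex.norm_mul_cos_arg]
  · rw [e, sin_sub_int_mul_two_pi, Complex.norm_mul_sin_arg]

lemma euclidean_dist_sq (p q : EuclideanSpace ℝ (Fin 2)) :
    dist p q ^ 2 = (p 0 - q 0) ^ 2 + (p 1 - q 1) ^ 2 := by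
  simp [EuclideanSpace.dist_sq_eq, Fin.sum_univ_two, Real.dist_eq, sq_abs]

lemma polar_dist_sq (r s x y : ℝ) :
    (r * cos x - s * cos y) ^ 2 + (r * sin x - s * sin y) ^ 2 =
      r ^ 2 + s ^ 2 - 2 * r * s * cos (x - y) := by
  rw [cos_sub]
  linear_combination r ^ 2 * sin_sq_add_cos_sq x + s ^ 2 * sin_sq_add_cos_sq y

lemma le_two_of_polar_sq {r x : ℝ} (h : (r * cos x) ^ 2 + (r * sin x) ^ 2 ≤ 4) : r ≤ 2 := by
  have : r ^ 2 ≤ 4 := by linear_combination h - r ^ 2 * sin_sq_add_cos_sq x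
  nlinarith

lemma polar_quadrilateral_dist_sq (r s d τ x y : ℝ) :
    (r * cos (τ + x) - (d * cos τ - s * cos (τ + y))) ^ 2 +
      (r * sin (τ + x) - (d * sin τ - s * sin (τ + y))) ^ 2 =
      d ^ 2 + r ^ 2 + s ^ 2 - 2 * d * r * cos x - 2 * d * s * cos y
        + 2 * r * s * cos (x - y) := by
  have h1 : cos x = cos ((τ + x) - τ) := by ring_nf
  have h2 : cos y = cos ((τ + y) - τ) := by ring_nf
  have h3 : cos (x - y) = cos ((τ + x) - (τ + y)) := by ring_nf
  rw [h1, h2, h3, cos_sub, cos_sub, cos_sub]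
  linear_combination d ^ 2 * sin_sq_add_cos_sq τ + r ^ 2 * sin_sq_add_cos_sq (τ + x) +
    s ^ 2 * sin_sq_add_cos_sq (τ + y)

/-- The double star obtained from an edge `uv` by attaching four pendant leaves to each
of `u` and `v` is not a unit disk graph: there is no such point configuration in the plane. -/
theorem no_double_star_unit_disk_representation :
    ¬ ∃ (u v : EuclideanSpace ℝ (Fin 2)) (a b : Fin 4 → EuclideanSpace ℝ (Fin 2)),
      dist u v ≤ 2 ∧
      (∀ i, dist u (a i) ≤ 2) ∧
      (∀ j, dist v (b j) ≤ 2) ∧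
      (∀ i j, i ≠ j → 2 < dist (a i) (a j)) ∧
      (∀ i j, i ≠ j → 2 < dist (b i) (b j)) ∧
      (∀ i j, 2 < dist (a i) (b j)) ∧
      (∀ i, 2 < dist v (a i)) ∧
      (∀ j, 2 < dist u (b j)) := by
  rintro ⟨u, v, a, b, huv, hua, hvb, haa, hbb, hab, hva, hub⟩
  have far : ∀ {p q : EuclideanSpace ℝ (Fin 2)}, 2 < dist p q →
      4 < (p 0 - q 0) ^ 2 + (p 1 - q 1) ^ 2 := fun {p q} h => by
    rw [← euclidean_dist_sq]; nlinarith
  have near : ∀ {p q : EuclideanSpace ℝ (Fin 2)}, dist p q ≤ 2 →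
      (p 0 - q 0) ^ 2 + (p 1 - q 1) ^ 2 ≤ 4 := fun {p q} h => by
    rw [← euclidean_dist_sq]; nlinarith [dist_nonneg (x := p) (y := q)]
  obtain ⟨d, τ, hd0, -, -, hx, hy⟩ := exists_polar (v 0 - u 0) (v 1 - u 1) 0
  rw [zero_add] at hx hy
  choose r θ hr0 hθ hθ' hax hay using fun i => exists_polar (a i 0 - u 0) (a i 1 - u 1) τ
  choose s φ hs0 hφ hφ' hbx hby using fun i => exists_polar (v 0 - b i 0) (v 1 - b i 1) τ
  have hd' : d ≤ 2 := by
    have h := near huv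
    rw [← neg_sq (u 0 - v 0), ← neg_sq (u 1 - v 1), neg_sub, neg_sub, hx, hy] at h
    exact le_two_of_polar_sq h
  have hr' : ∀ i, r i ≤ 2 := fun i => by
    have h := near (hua i)
    rw [← neg_sq (u 0 - _), ← neg_sq (u 1 - _), neg_sub, neg_sub, hax, hay] at h
    exact le_two_of_polar_sq h
  have hs' : ∀ i, s i ≤ 2 := fun i => by
    have h := near (hvb i)
    rw [hbx, hby] at h
    exact le_two_of_polar_sq h
  have hrr : ∀ i j, i ≠ j → 4 < r i ^ 2 + r j ^ 2 - 2 * r i * r j * cos (θ i - θ j) := by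
    intro i j hij
    have h := far (haa i j hij)
    rw [← add_sub_add_left_eq_sub (θ i) (θ j) τ, ← polar_dist_sq, ← hax, ← hay, ← hax, ← hay]
    ring_nf at h ⊢
    exact h
  have hss : ∀ i j, i ≠ j → 4 < s i ^ 2 + s j ^ 2 - 2 * s i * s j * cos (φ i - φ j) := by
    intro i j hij
    have h := far (hbb j i hij.symm)
    rw [← add_sub_add_left_eq_sub (φ i) (φ j) τ, ← polar_dist_sq, ← hbx, ← hby, ← hbx, ← hby]
    ring_nf at h ⊢
    exact h
  have hrd : ∀ i, 4 < r i ^ 2 + d ^ 2 - 2 * r i * d * cos (θ i) := by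
    intro i
    have h := far (dist_comm v (a i) ▸ hva i)
    rw [← add_sub_cancel_left τ (θ i), ← polar_dist_sq, ← hax, ← hay, ← hx, ← hy]
    ring_nf at h ⊢
    exact h
  have hsd : ∀ i, 4 < s i ^ 2 + d ^ 2 - 2 * s i * d * cos (φ i) := by
    intro i
    have h := far (hub i)
    rw [← add_sub_cancel_left τ (φ i), ← polar_dist_sq, ← hbx, ← hby, ← hx, ← hy]
    ring_nf at h ⊢
    exact h
  have hrs : ∀ i j, 4 < d ^ 2 + r i ^ 2 + s j ^ 2 - 2 * d * r i * cos (θ i)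
      - 2 * d * s j * cos (φ j) + 2 * r i * s j * cos (θ i - φ j) := by
    intro i j
    have h := far (hab i j)
    rw [← polar_quadrilateral_dist_sq (r i) (s j) d τ, ← hax, ← hay, ← hbx, ← hby, ← hx, ← hy]
    ring_nf at h ⊢
    exact h
  have hd : 0 < d := hd0.lt_of_ne' fun h => by
    have := hrd 0
    rw [h] at this
    nlinarith [hr' 0, hr0 0]
  have hr : ∀ i, 0 < r i := fun i => (hr0 i).lt_of_ne' fun h => by
    have := hrd i
    rw [h] at this
    nlinarith
  have hs : ∀ i, 0 < s i := fun i => (hs0 i).lt_of_ne' fun h => by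
    have := hsd i
    rw [h] at this
    nlinarith
  obtain ⟨i, j, hi, hj, hij⟩ := star_angles hd hd' hr hr' hθ hθ' hrr hrd
  obtain ⟨k, l, hk, hl, hkl⟩ := star_angles hd hd' hs hs' hφ hφ' hss hsd
  have hil := quadrilateral_angles (β := 2 * π - φ l) (hr i) (hr' i) (hs l) (hs' l) hd' hi hl
    (two_mul_mul_cos_le (hr i) (hr' i) hd (hrd i))
    (by rw [cos_two_pi_sub]; exact two_mul_mul_cos_le (hs l) (hs' l) hd (hsd l))
    (by
      rw [cos_two_pi_sub, show θ i + (2 * π - φ l) = θ i - φ l + 2 * π by ring, cos_add_two_pi]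
      exact hrs i l)
  have hjk := quadrilateral_angles (α := 2 * π - θ j) (hr j) (hr' j) (hs k) (hs' k) hd' hj hk
    (by rw [cos_two_pi_sub]; exact two_mul_mul_cos_le (hr j) (hr' j) hd (hrd j))
    (two_mul_mul_cos_le (hs k) (hs' k) hd (hsd k))
    (by
      rw [cos_two_pi_sub, show 2 * π - θ j + φ k = 2 * π - (θ j - φ k) by ring, cos_two_pi_sub]
      exact hrs j k)
  linarith
end

section
/- Let G be a caterpillar, i.e., a finite tree such that deleting all leaves (vertices of degree at most 1) yields a path (the backbone). If G contains two adjacent vertices u and v with deg(u) = deg(v) = 5 (such vertices necessarily lie on the backbone), then G does not admit a unit disk intersection representation: there is no map d : V(G) → ℝ² such that for all distinct vertices x, y, the vertices x and y are adjacent in G if and only if dist(d(x), d(y)) ≤ 2. -/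
/-- A graph is a path graph if its vertices can be enumerated `0, 1, …, n-1` such that
two vertices are adjacent iff they are consecutive in the enumeration
(this includes the empty and one-vertex cases). -/
def IsPathGraph {W : Type*} (H : SimpleGraph W) : Prop :=
  ∃ (n : ℕ) (e : W ≃ Fin n),
    ∀ a b : W, H.Adj a b ↔ ((e a : ℕ) + 1 = (e b : ℕ) ∨ (e b : ℕ) + 1 = (e a : ℕ))

/-- A caterpillar is a finite tree such that deleting all leaves (vertices of degree at
most 1) yields a path, i.e. the subgraph induced on the vertices of degree at least 2
is a path graph. -/
def IsCaterpillar {V : Type*} [Fintype V] (G : SimpleGraph V) [DecidableRel G.Adj] : Prop :=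
  G.IsTree ∧ IsPathGraph (G.induce {v : V | 2 ≤ G.degree v})

/-- A unit disk intersection representation (UDR) of a simple graph `G`:
distinct vertices are adjacent iff their disk centers are at distance at most 2. -/
def IsUDR {V : Type*} (G : SimpleGraph V) (d : V → EuclideanSpace ℝ (Fin 2)) : Prop :=
  ∀ u v : V, u ≠ v → (G.Adj u v ↔ dist (d u) (d v) ≤ 2)

open Real in
/-- The trigonometric inequality behind `sq_dist_le_four`, in terms of `cos σ = s / 4` and
`cos τ = t / 4`. -/
lemma cos_quadratic_nonpos {σ τ α β : ℝ} (hσ : π / 3 ≤ σ) (hσ' : σ ≤ π / 2)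
    (hτ : π / 3 ≤ τ) (hτ' : τ ≤ π / 2) (hα : σ < α) (hβ : τ < β)
    (hsum : α + β + σ + τ ≤ 5 * π / 3) :
    cos σ ^ 2 + cos τ ^ 2 + 2 * cos σ * cos τ * cos (α + β)
      ≤ cos σ * cos α + cos τ * cos β := by
  have hpi := pi_pos
  have hx : 0 ≤ cos σ := cos_nonneg_of_mem_Icc ⟨by linarith, hσ'⟩
  have hy : 0 ≤ cos τ := cos_nonneg_of_mem_Icc ⟨by linarith, hτ'⟩
  have end_bound : ∀ {p q : ℝ}, π / 3 ≤ p → π / 3 ≤ q → p ≤ π / 2 → p + q ≤ α + β →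
      α + β + p + q ≤ 5 * π / 3 → cos p + cos (α + β + q) ≤ 0 := by
    intro p q hp hq hp' h1 h2
    have h : cos p ≤ cos (α + β + q - π) :=
      cos_le_cos_of_nonneg_of_le_pi (by linarith) (by linarith) (by linarith)
    rw [cos_sub_pi] at h
    linarith
  have e1 := mul_nonpos_of_nonneg_of_nonpos hx
    (end_bound hσ hτ hσ' (by linarith) (by linarith))
  have e2 := mul_nonpos_of_nonneg_of_nonpos hy
    (end_bound hτ hσ hτ' (by linarith) (by linarith))
  have hsp : 0 < sin (α + β - τ - σ) := sin_pos_of_pos_of_lt_pi (by linarith) (by linarith)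
  have hs1 : 0 ≤ sin (β - τ) := sin_nonneg_of_nonneg_of_le_pi (by linarith) (by linarith)
  have hs2 : 0 ≤ sin (α - σ) := sin_nonneg_of_nonneg_of_le_pi (by linarith) (by linarith)
  set K := cos σ ^ 2 + cos τ ^ 2 + 2 * cos σ * cos τ * cos (α + β) with hK
  have hK0 : 0 ≤ K := by
    nlinarith [sq_nonneg (cos σ - cos τ), neg_one_le_cos (α + β), mul_nonneg hx hy]
  have hp : K ≤ cos σ * cos σ + cos τ * cos (α + β - σ) := by
    rw [cos_add (α + β) σ] at e2
    rw [cos_sub, hK]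
    linarith
  have hq : K ≤ cos σ * cos (α + β - τ) + cos τ * cos τ := by
    rw [cos_add (α + β) τ] at e1
    rw [cos_sub, hK]
    linarith
  have hsub : sin (α + β - τ - σ) ≤ sin (β - τ) + sin (α - σ) := by
    rw [show α + β - τ - σ = (β - τ) + (α - σ) by ring, sin_add]
    nlinarith [cos_le_one (β - τ), cos_le_one (α - σ)]
  have interp : ∀ x y z : ℝ, sin (z - x) * cos y = sin (z - y) * cos x + sin (y - x) * cos z := by
    intro x y z
    simp only [sin_sub]
    ring
  have i1 := interp σ α (α + β - τ)
  have i2 := interp (α + β - σ) β τ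
  rw [show α + β - τ - α = β - τ by ring] at i1
  rw [show τ - (α + β - σ) = -(α + β - τ - σ) by ring, show τ - β = -(β - τ) by ring,
    show β - (α + β - σ) = -(α - σ) by ring, sin_neg, sin_neg, sin_neg] at i2
  refine le_of_mul_le_mul_left ?_ hsp
  calc sin (α + β - τ - σ) * K ≤ (sin (β - τ) + sin (α - σ)) * K :=
        mul_le_mul_of_nonneg_right hsub hK0
    _ ≤ sin (β - τ) * (cos σ * cos σ + cos τ * cos (α + β - σ))
        + sin (α - σ) * (cos σ * cos (α + β - τ) + cos τ * cos τ) := by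
        rw [add_mul]
        exact add_le_add (mul_le_mul_of_nonneg_left hp hs1) (mul_le_mul_of_nonneg_left hq hs2)
    _ = sin (α + β - τ - σ) * (cos σ * cos α + cos τ * cos β) := by
        linear_combination (-cos σ) * i1 + cos τ * i2

lemma pi_div_three_le_arccos_s4 {s : ℝ} (hs : s ≤ 2) : Real.pi / 3 ≤ Real.arccos (s / 4) := by
  have h : Real.arccos (1 / 2) = Real.pi / 3 := by
    rw [← Real.cos_pi_div_three]
    exact Real.arccos_cos (by positivity) (by linarith [Real.pi_pos])
  rw [← h]
  exact Real.arccos_le_arccos (by linarith)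

open Real in
/-- Two points at angles `α` and `β` on the same side of a segment of length `r` are close
to each other when the angles are small. -/
lemma sq_dist_le_four {r s t α β : ℝ} (hr : r ≤ 2) (hs0 : 0 < s) (hs : s ≤ 2)
    (ht0 : 0 < t) (ht : t ≤ 2) (hα : arccos (s / 4) < α) (hβ : arccos (t / 4) < β)
    (hsum : α + β + arccos (s / 4) + arccos (t / 4) ≤ 5 * π / 3)
    (hsr : 2 * s * cos α ≤ r) (htr : 2 * t * cos β ≤ r) :
    r ^ 2 + s ^ 2 + t ^ 2 - 2 * r * s * cos α - 2 * r * t * cos β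
      + 2 * s * t * cos (α + β) ≤ 4 := by
  have h := cos_quadratic_nonpos (pi_div_three_le_arccos_s4 hs)
    (arccos_le_pi_div_two.2 (by positivity)) (pi_div_three_le_arccos_s4 ht)
    (arccos_le_pi_div_two.2 (by positivity)) hα hβ hsum
  rw [cos_arccos (by linarith) (by linarith), cos_arccos (by linarith) (by linarith)] at h
  nlinarith [mul_nonneg (sub_nonneg.2 hr)
    (show 0 ≤ 2 + r - 2 * s * cos α - 2 * t * cos β by linarith)]

open Real in
/-- The angular gap between two points of a disk of radius 2 whose distance exceeds 2. -/
lemma arccos_lt_of_four_lt {ρ ρ' Δ : ℝ} (h0 : 0 < ρ) (h2 : ρ ≤ 2) (h0' : 0 < ρ') (h2' : ρ' ≤ 2)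
    (hΔ : 0 ≤ Δ) (h : 4 < ρ ^ 2 + ρ' ^ 2 - 2 * ρ * ρ' * cos Δ) : arccos (ρ / 4) < Δ := by
  by_contra! hle
  have hc := cos_le_cos_of_nonneg_of_le_pi hΔ (arccos_le_pi _) hle
  rw [cos_arccos (by linarith) (by linarith)] at hc
  have h3 := mul_le_mul_of_nonneg_left hc (mul_pos h0 h0').le
  nlinarith [mul_nonneg (sub_nonneg.2 h2') (show 0 ≤ 2 + ρ' - ρ ^ 2 / 2 by nlinarith)]

lemma exists_polar_s4 (z : ℂ) : ∃ θ : ℝ, 0 ≤ θ ∧ θ ≤ 2 * Real.pi ∧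
    z.re = ‖z‖ * Real.cos θ ∧ z.im = ‖z‖ * Real.sin θ := by
  refine ⟨Complex.arg (-z) + Real.pi, ?_, ?_, ?_, ?_⟩
  · linarith [Complex.neg_pi_lt_arg (-z)]
  · linarith [Complex.arg_le_pi (-z)]
  · have := Complex.norm_mul_cos_arg (-z)
    rw [norm_neg, Complex.neg_re] at this
    rw [Real.cos_add_pi]
    linarith
  · have := Complex.norm_mul_sin_arg (-z)
    rw [norm_neg, Complex.neg_im] at this
    rw [Real.sin_add_pi]
    linarith

/-- If `r` and four further points lie in the disk of radius 2 about the origin, at pairwise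
distances exceeding 2, then the first points met when turning from `r` in either direction
are seen under small angles. -/
lemma exists_small_angles {r : ℝ} (hr0 : 0 < r) (hr : r ≤ 2) (z : Fin 4 → ℂ)
    (hz : ∀ i, ‖z i‖ ≤ 2) (hzr : ∀ i, 2 < ‖z i - r‖) (hzz : ∀ i j, i ≠ j → 2 < ‖z i - z j‖) :
    ∃ (i j : Fin 4) (s s' α α' : ℝ), 0 < s ∧ s ≤ 2 ∧ 0 < s' ∧ s' ≤ 2 ∧
      Real.arccos (s / 4) < α ∧ Real.arccos (s' / 4) < α' ∧
      α + Real.arccos (s / 4) + (α' + Real.arccos (s' / 4)) < 5 * Real.pi / 3 ∧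
      2 * s * Real.cos α ≤ r ∧ 2 * s' * Real.cos α' ≤ r ∧
      (z i).re = s * Real.cos α ∧ (z i).im = s * Real.sin α ∧
      (z j).re = s' * Real.cos α' ∧ (z j).im = -(s' * Real.sin α') := by
  choose θ' hθ0' hθ2' hre' him' using fun i => exists_polar_s4 (z i)
  set e := Tuple.sort θ'
  have hmono : Monotone (θ' ∘ e) := Tuple.monotone_sort θ'
  set θ : Fin 4 → ℝ := θ' ∘ e
  set ρ : Fin 4 → ℝ := fun i => ‖z (e i)‖
  have hre : ∀ i, (z (e i)).re = ρ i * Real.cos (θ i) := fun i => hre' (e i)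
  have him : ∀ i, (z (e i)).im = ρ i * Real.sin (θ i) := fun i => him' (e i)
  have hρ2 : ∀ i, ρ i ≤ 2 := fun i => hz (e i)
  have hρ0 : ∀ i, 0 < ρ i := by
    intro i
    refine norm_pos_iff.2 fun h => ?_
    have := hzr (e i)
    rw [h, zero_sub, norm_neg, Complex.norm_real, Real.norm_of_nonneg hr0.le] at this
    linarith
  have four_lt : ∀ {w : ℂ}, 2 < ‖w‖ → 4 < w.re * w.re + w.im * w.im := by
    intro w hw
    rw [← Complex.normSq_apply, ← Complex.sq_norm]
    nlinarith
  have hr4 : ∀ i, 4 < ρ i ^ 2 + r ^ 2 - 2 * ρ i * r * Real.cos (θ i) := by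
    intro i
    have := four_lt (hzr (e i))
    simp only [Complex.sub_re, Complex.sub_im, Complex.ofReal_re, Complex.ofReal_im, hre, him]
      at this
    nlinarith [Real.sin_sq_add_cos_sq (θ i)]
  have hd4 : ∀ i j, i ≠ j →
      4 < ρ i ^ 2 + ρ j ^ 2 - 2 * ρ i * ρ j * Real.cos (θ j - θ i) := by
    intro i j hij
    have := four_lt (hzz (e i) (e j) (e.injective.ne hij))
    simp only [Complex.sub_re, Complex.sub_im, hre, him] at this
    rw [Real.cos_sub]
    linear_combination this + ρ i ^ 2 * Real.sin_sq_add_cos_sq (θ i)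
      + ρ j ^ 2 * Real.sin_sq_add_cos_sq (θ j)
  have hside : ∀ i, 2 * ρ i * Real.cos (θ i) ≤ r := by
    intro i
    have h1 := hr4 i
    have h2 : ρ i ^ 2 ≤ 4 := by nlinarith [hρ2 i, hρ0 i]
    by_contra! h
    nlinarith [mul_lt_mul_of_pos_left h hr0]
  have cos3 : Real.cos (2 * Real.pi - θ 3) = Real.cos (θ 3) := Real.cos_two_pi_sub _
  have hθ2 : ∀ i, θ i ≤ 2 * Real.pi := fun i => hθ2' (e i)
  have hθ0 : ∀ i, 0 ≤ θ i := fun i => hθ0' (e i)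
  have g0 : Real.arccos (ρ 0 / 4) < θ 0 :=
    arccos_lt_of_four_lt (hρ0 _) (hρ2 _) hr0 hr (hθ0 0) (hr4 0)
  have g4 : Real.arccos (ρ 3 / 4) < 2 * Real.pi - θ 3 :=
    arccos_lt_of_four_lt (hρ0 _) (hρ2 _) hr0 hr (by linarith [hθ2 3]) (by rw [cos3]; exact hr4 3)
  have gap : ∀ i j, i < j → Real.arccos (ρ i / 4) < θ j - θ i := fun i j hij =>
    arccos_lt_of_four_lt (hρ0 _) (hρ2 _) (hρ0 _) (hρ2 _) (sub_nonneg.2 (hmono hij.le))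
      (hd4 i j hij.ne)
  have g1 := gap 0 1 (by decide)
  have g2 := (pi_div_three_le_arccos_s4 (hρ2 1)).trans_lt (gap 1 2 (by decide))
  have g3 : Real.arccos (ρ 3 / 4) < θ 3 - θ 2 :=
    arccos_lt_of_four_lt (hρ0 _) (hρ2 _) (hρ0 2) (hρ2 2)
      (sub_nonneg.2 (hmono (by decide : (2 : Fin 4) ≤ 3)))
      (by
        have := hd4 2 3 (by decide)
        linarith)
  refine ⟨e 0, e 3, ρ 0, ρ 3, θ 0, 2 * Real.pi - θ 3, hρ0 _, hρ2 _, hρ0 _, hρ2 _, g0, g4,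
    by linarith, hside 0, by rw [cos3]; exact hside 3, hre 0, him 0, by rw [cos3]; exact hre 3, ?_⟩
  rw [Real.sin_two_pi_sub, him 3]
  ring

lemma norm_le_two_of_small_angles {r s t α β : ℝ} {a b : ℂ} (hr : r ≤ 2) (hs0 : 0 < s)
    (hs : s ≤ 2) (ht0 : 0 < t) (ht : t ≤ 2) (hα : Real.arccos (s / 4) < α)
    (hβ : Real.arccos (t / 4) < β)
    (hsum : α + β + Real.arccos (s / 4) + Real.arccos (t / 4) ≤ 5 * Real.pi / 3)
    (hsr : 2 * s * Real.cos α ≤ r) (htr : 2 * t * Real.cos β ≤ r)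
    (hare : a.re = s * Real.cos α) (haim : a.im = s * Real.sin α)
    (hbre : b.re = t * Real.cos β) (hbim : b.im = -(t * Real.sin β)) : ‖a + b - r‖ ≤ 2 := by
  have h := sq_dist_le_four hr hs0 hs ht0 ht hα hβ hsum hsr htr
  refine le_of_sq_le_sq ?_ zero_le_two
  rw [Complex.sq_norm, Complex.normSq_apply]
  simp only [Complex.sub_re, Complex.sub_im, Complex.add_re, Complex.add_im, Complex.ofReal_re,
    Complex.ofReal_im, hare, haim, hbre, hbim]
  rw [Real.cos_add] at h
  linear_combination h + s ^ 2 * Real.sin_sq_add_cos_sq α + t ^ 2 * Real.sin_sq_add_cos_sq β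

/-- Two adjacent stars with four further leaves each, centred at `0` and `r`; the leaves of the
second star are `r - w i`. -/
lemma exists_close_leaves {r : ℝ} (hr0 : 0 < r) (hr : r ≤ 2) (z w : Fin 4 → ℂ)
    (hz : ∀ i, ‖z i‖ ≤ 2) (hzr : ∀ i, 2 < ‖z i - r‖) (hzz : ∀ i j, i ≠ j → 2 < ‖z i - z j‖)
    (hw : ∀ i, ‖w i‖ ≤ 2) (hwr : ∀ i, 2 < ‖w i - r‖) (hww : ∀ i j, i ≠ j → 2 < ‖w i - w j‖) :
    ∃ i j, ‖z i + w j - r‖ ≤ 2 := by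
  obtain ⟨i, j, s, s', α, α', hs0, hs, hs0', hs', hα, hα', hsum, hsr, hsr', h1, h2, h3, h4⟩ :=
    exists_small_angles hr0 hr z hz hzr hzz
  obtain ⟨k, l, t, t', β, β', ht0, ht, ht0', ht', hβ, hβ', hsum', htr, htr', k1, k2, k3, k4⟩ :=
    exists_small_angles hr0 hr w hw hwr hww
  rcases le_total (α + β' + Real.arccos (s / 4) + Real.arccos (t' / 4)) (5 * Real.pi / 3)
    with h | h
  · exact ⟨i, l, norm_le_two_of_small_angles hr hs0 hs ht0' ht' hα hβ' h hsr htr' h1 h2 k3 k4⟩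
  · refine ⟨j, k, ?_⟩
    rw [add_comm (z j)]
    exact norm_le_two_of_small_angles hr ht0 ht hs0' hs' hβ hα' (by linarith) htr hsr'
      k1 k2 h3 h4

/-- Coordinate-free form of `exists_close_leaves`. -/
lemma exists_dist_le_two {A B : ℂ} (hne : A ≠ B) (hAB : dist A B ≤ 2) (a b : Fin 4 → ℂ)
    (ha : ∀ i, dist (a i) A ≤ 2) (haB : ∀ i, 2 < dist (a i) B)
    (haa : ∀ i j, i ≠ j → 2 < dist (a i) (a j))
    (hb : ∀ i, dist (b i) B ≤ 2) (hbA : ∀ i, 2 < dist (b i) A)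
    (hbb : ∀ i j, i ≠ j → 2 < dist (b i) (b j)) :
    ∃ i j, dist (a i) (b j) ≤ 2 := by
  set r := ‖B - A‖ with hr
  have hr0 : 0 < r := norm_pos_iff.2 (sub_ne_zero.2 hne.symm)
  set c : ℂ := r / (B - A) with hc
  have hBA : B - A ≠ 0 := sub_ne_zero.2 hne.symm
  have hcn : ‖c‖ = 1 := by
    rw [hc, norm_div, Complex.norm_real, Real.norm_of_nonneg hr0.le, ← hr, div_self hr0.ne']
  have hcr : (r : ℂ) = c * (B - A) := by rw [hc, div_mul_cancel₀ _ hBA]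
  have hdist : ∀ x y w : ℂ, w = c * (x - y) ∨ w = c * (y - x) → ‖w‖ = dist x y := by
    rintro x y w (rfl | rfl)
    · rw [norm_mul, hcn, one_mul, dist_eq_norm]
    · rw [norm_mul, hcn, one_mul, dist_comm, dist_eq_norm]
  obtain ⟨i, j, h⟩ := exists_close_leaves (r := r) hr0
    (by rwa [hr, ← dist_eq_norm, dist_comm]) (fun i => c * (a i - A)) (fun i => c * (B - b i))
    (fun i => by rw [hdist (a i) A _ (Or.inl rfl)]; exact ha i)
    (fun i => by rw [hdist (a i) B _ (Or.inl (by rw [hcr]; ring))]; exact haB i)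
    (fun i j hij => by rw [hdist (a i) (a j) _ (Or.inl (by ring))]; exact haa i j hij)
    (fun i => by rw [hdist (b i) B _ (Or.inr rfl)]; exact hb i)
    (fun i => by rw [hdist (b i) A _ (Or.inr (by rw [hcr]; ring))]; exact hbA i)
    (fun i j hij => by rw [hdist (b i) (b j) _ (Or.inr (by ring))]; exact hbb i j hij)
  exact ⟨i, j, by rwa [hdist (a i) (b j) _ (Or.inl (by rw [hcr]; ring))] at h⟩

lemma SimpleGraph.IsAcyclic.not_adj_of_adj_adj {V : Type*} {G : SimpleGraph V}
    (hG : G.IsAcyclic) {a b c : V} (hab : G.Adj a b) (hbc : G.Adj b c) : ¬ G.Adj c a := by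
  intro hca
  refine hG (.cons hab (.cons hbc (.cons hca .nil))) ?_
  simp [SimpleGraph.Walk.cons_isCycle_iff, hab.ne, hbc.ne, hca.ne, hab.ne', hca.ne']

lemma SimpleGraph.IsAcyclic.not_adj_of_adj_adj_adj {V : Type*} {G : SimpleGraph V}
    (hG : G.IsAcyclic) {a b c d : V} (hab : G.Adj a b) (hbc : G.Adj b c) (hcd : G.Adj c d)
    (hac : a ≠ c) (hbd : b ≠ d) : ¬ G.Adj d a := by
  intro hda
  refine hG (.cons hab (.cons hbc (.cons hcd (.cons hda .nil)))) ?_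
  simp [SimpleGraph.Walk.cons_isCycle_iff, hab.ne, hbc.ne, hcd.ne, hda.ne, hab.ne', hda.ne',
    hac, hbd, hac.symm]

lemma SimpleGraph.exists_four_neighbors {V : Type*} [Fintype V] (G : SimpleGraph V)
    [DecidableRel G.Adj] {u v : V} (huv : G.Adj u v) (hu : G.degree u = 5) :
    ∃ a : Fin 4 → V, Function.Injective a ∧ ∀ i, G.Adj u (a i) ∧ a i ≠ v := by
  classical
  have hcard : ((G.neighborFinset u).erase v).card = 4 := by
    rw [Finset.card_erase_of_mem (by simpa using huv), G.card_neighborFinset_eq_degree, hu]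
  let e := (Finset.equivFinOfCardEq hcard).symm
  refine ⟨fun i => e i, Subtype.val_injective.comp e.injective, fun i => ?_⟩
  have := (e i).2
  rw [Finset.mem_erase, SimpleGraph.mem_neighborFinset] at this
  exact this.symm

/-- A caterpillar containing two adjacent vertices of degree 5 admits no unit disk
intersection representation. -/
theorem caterpillar_no_UDR_of_adjacent_degree_five
    {V : Type*} [Fintype V] (G : SimpleGraph V) [DecidableRel G.Adj]
    (hcat : IsCaterpillar G) (u v : V) (huv : G.Adj u v)
    (hu : G.degree u = 5) (hv : G.degree v = 5) :
    ¬ ∃ d : V → EuclideanSpace ℝ (Fin 2), IsUDR G d := by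
  rintro ⟨d, hd⟩
  have hG : G.IsAcyclic := hcat.1.isAcyclic
  obtain ⟨a, ha, hua⟩ := G.exists_four_neighbors huv hu
  obtain ⟨b, hb, hvb⟩ := G.exists_four_neighbors huv.symm hv
  let f : V → ℂ := fun x => Complex.orthonormalBasisOneI.repr.symm (d x)
  have hf : ∀ x y, dist (f x) (f y) = dist (d x) (d y) := fun x y =>
    Complex.orthonormalBasisOneI.repr.symm.dist_map _ _
  have near : ∀ {x y}, G.Adj x y → dist (f x) (f y) ≤ 2 := fun {x y} h => by
    rw [hf]
    exact (hd x y h.ne).1 h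
  have far : ∀ {x y}, x ≠ y → ¬ G.Adj x y → 2 < dist (f x) (f y) := fun {x y} hne h => by
    rw [hf]
    exact not_le.1 (mt (hd x y hne).2 h)
  have hav : ∀ i, ¬ G.Adj (a i) v := fun i =>
    fun h => hG.not_adj_of_adj_adj (hua i).1 h huv.symm
  have hbu : ∀ i, ¬ G.Adj (b i) u := fun i =>
    fun h => hG.not_adj_of_adj_adj (hvb i).1 h huv
  have hfuv : f u ≠ f v := by
    intro h
    have := far (hua 0).2 (hav 0)
    rw [← h] at this
    exact absurd (near (hua 0).1.symm) (not_le.2 this)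
  obtain ⟨i, j, hij⟩ := exists_dist_le_two hfuv (near huv) (f ∘ a) (f ∘ b)
    (fun i => near (hua i).1.symm) (fun i => far (hua i).2 (hav i))
    (fun i j hij => far (ha.ne hij) fun h =>
      hG.not_adj_of_adj_adj (hua i).1 h (hua j).1.symm)
    (fun i => near (hvb i).1.symm) (fun i => far (hvb i).2 (hbu i))
    (fun i j hij => far (hb.ne hij) fun h =>
      hG.not_adj_of_adj_adj (hvb i).1 h (hvb j).1.symm)
  have hne : a i ≠ b j := fun h => hav i (h ▸ (hvb j).1.symm)
  refine absurd hij (not_le.2 (far hne fun h => ?_))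
  exact hG.not_adj_of_adj_adj_adj (hua i).1 h (hvb j).1.symm (hvb j).2.symm (hua i).2 huv.symm
end

section
/- Every caterpillar G of maximum degree at most 4 admits a unit disk contact representation: there exists a map d : V(G) → ℝ² such that for all distinct vertices u, v, dist(d(u), d(v)) = 2 if u and v are adjacent in G, and dist(d(u), d(v)) > 2 if u and v are not adjacent in G. -/
/-- A unit disk contact representation (UDC) of a simple graph `G`: disks of adjacent
vertices touch (centers at distance exactly 2) and disks of distinct non-adjacent
vertices are disjoint (centers at distance greater than 2). -/
def IsUDC {V : Type*} (G : SimpleGraph V) (d : V → EuclideanSpace ℝ (Fin 2)) : Prop :=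
  ∀ u v : V, u ≠ v →
    (G.Adj u v → dist (d u) (d v) = 2) ∧ (¬ G.Adj u v → 2 < dist (d u) (d v))

/-- The infinite comb with two teeth per spine vertex: the spine vertices `(i, 0)` form a ray, and
each `(i, 0)` is adjacent to the two teeth `(i, 1)` and `(i, -1)`. -/
def doubleComb : SimpleGraph (ℕ × SignType) where
  Adj a b := (a.2 = 0 ∧ b.2 = 0 ∧ (a.1 + 1 = b.1 ∨ b.1 + 1 = a.1)) ∨
    (a.1 = b.1 ∧ ((a.2 = 0 ∧ b.2 ≠ 0) ∨ (a.2 ≠ 0 ∧ b.2 = 0)))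
  symm := ⟨fun a b h => by grind⟩
  loopless := ⟨fun a h => by grind⟩

/-- Half the horizontal offset of the teeth at the `i`-th spine vertex; strictly increasing with
values in `[0, 1/2)`. -/
noncomputable def toothShift (i : ℕ) : ℝ := 1 / 2 - 1 / (2 * (i + 1))

theorem toothShift_strictMono : StrictMono toothShift := by
  refine strictMono_nat_of_lt_succ fun i => ?_
  unfold toothShift
  push_cast
  gcongr
  linarith

theorem toothShift_nonneg (i : ℕ) : 0 ≤ toothShift i := by
  have h := toothShift_strictMono.monotone (Nat.zero_le i)
  have h0 : toothShift 0 = 0 := by norm_num [toothShift]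
  linarith

theorem toothShift_lt_half (i : ℕ) : toothShift i < 1 / 2 := by
  have : (0 : ℝ) < 1 / (2 * (i + 1)) := by positivity
  unfold toothShift
  linarith

/-- A contact representation of the double comb: the spine is straight, the teeth fan out. -/
noncomputable def doubleCombPoint (a : ℕ × SignType) : EuclideanSpace ℝ (Fin 2) :=
  !₂[2 * (a.1 : ℝ) + 2 * (a.2 : ℝ) ^ 2 * toothShift a.1,
    2 * (a.2 : ℝ) * √(1 - toothShift a.1 ^ 2)]

theorem dist_doubleCombPoint_sq (a b : ℕ × SignType) :
    dist (doubleCombPoint a) (doubleCombPoint b) ^ 2 =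
      ((2 * (a.1 : ℝ) + 2 * (a.2 : ℝ) ^ 2 * toothShift a.1) -
        (2 * (b.1 : ℝ) + 2 * (b.2 : ℝ) ^ 2 * toothShift b.1)) ^ 2 +
      (2 * (a.2 : ℝ) * √(1 - toothShift a.1 ^ 2) -
        2 * (b.2 : ℝ) * √(1 - toothShift b.1 ^ 2)) ^ 2 := by
  rw [EuclideanSpace.dist_eq, Real.sq_sqrt (by positivity)]
  simp [doubleCombPoint, Real.dist_eq, sq_abs]

theorem dist_doubleCombPoint_of_adj {a b : ℕ × SignType} (h : doubleComb.Adj a b) :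
    dist (doubleCombPoint a) (doubleCombPoint b) = 2 := by
  rw [← sq_eq_sq₀ dist_nonneg zero_le_two, dist_doubleCombPoint_sq]
  obtain ⟨i, s⟩ := a
  obtain ⟨j, t⟩ := b
  have hs : √(1 - toothShift i ^ 2) ^ 2 = 1 - toothShift i ^ 2 :=
    Real.sq_sqrt (by nlinarith [toothShift_nonneg i, toothShift_lt_half i])
  rcases h with ⟨rfl, rfl, h⟩ | ⟨rfl, h⟩
  · rcases h with rfl | rfl <;> simp <;> ring
  · cases s <;> cases t <;> simp at h <;> simp <;> nlinarith [hs]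

theorem two_lt_dist_doubleCombPoint {a b : ℕ × SignType} (hne : a ≠ b)
    (h : ¬ doubleComb.Adj a b) : 2 < dist (doubleCombPoint a) (doubleCombPoint b) := by
  wlog hle : a.1 ≤ b.1 generalizing a b
  · rw [dist_comm]
    exact this hne.symm (fun h' => h h'.symm) (by omega)
  refine lt_of_pow_lt_pow_left₀ 2 dist_nonneg ?_
  rw [dist_doubleCombPoint_sq]
  obtain ⟨i, s⟩ := a
  obtain ⟨j, t⟩ := b
  have hi0 := toothShift_nonneg i
  have hi1 := toothShift_lt_half i
  have hj0 := toothShift_nonneg j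
  have hs : √(1 - toothShift i ^ 2) ^ 2 = 1 - toothShift i ^ 2 :=
    Real.sq_sqrt (by nlinarith)
  simp only [doubleComb] at h hle hne ⊢
  have far (x y : ℝ) (hx : x < -2) : (2 : ℝ) ^ 2 < x ^ 2 + y ^ 2 := by nlinarith [sq_nonneg y]
  rcases hle.eq_or_lt with rfl | hlt
  · cases s <;> cases t <;> simp at h hne <;> simp <;> nlinarith
  have hmono := toothShift_strictMono hlt
  obtain rfl | hlt := (Nat.succ_le_of_lt hlt).eq_or_lt
  · push_cast
    cases s <;> cases t <;> simp at h <;> simp <;> nlinarith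
  · have hij : (i : ℝ) + 2 ≤ j := by exact_mod_cast hlt
    apply far
    cases s <;> cases t <;> simp <;> linarith

theorem exists_isUDC_of_embedding {V : Type*} {G : SimpleGraph V} (f : G ↪g doubleComb) :
    ∃ d : V → EuclideanSpace ℝ (Fin 2), IsUDC G d := by
  refine ⟨doubleCombPoint ∘ f, fun u v huv => ?_⟩
  rw [← f.map_adj_iff]
  exact ⟨dist_doubleCombPoint_of_adj, two_lt_dist_doubleCombPoint (f.injective.ne huv)⟩

namespace SimpleGraph

variable {V : Type*} [Fintype V] {G : SimpleGraph V} [DecidableRel G.Adj]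

theorem Adj.eq_of_degree_le_one {u v w : V} (huv : G.Adj u v) (huw : G.Adj u w)
    (hu : G.degree u ≤ 1) : v = w :=
  Finset.card_le_one.1 hu v (by simpa using huv) w (by simpa using huw)

theorem Preconnected.eq_or_eq_of_adj_of_degree_le_one (hG : G.Preconnected) {u v : V}
    (huv : G.Adj u v) (hu : G.degree u ≤ 1) (hv : G.degree v ≤ 1) (w : V) :
    w = u ∨ w = v := by
  obtain ⟨p⟩ := hG w u
  induction p with
  | nil => exact .inl rfl
  | cons h p ih =>
    rcases ih huv hu with rfl | rfl
    · exact .inr (h.symm.eq_of_degree_le_one huv hu)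
    · exact .inl (h.symm.eq_of_degree_le_one huv.symm hv)

/-- The case of a caterpillar in which every leaf hangs on the backbone; `idx` numbers the
backbone from `1` to `n`. -/
theorem nonempty_embedding_doubleComb (hdeg : ∀ v, G.degree v ≤ 4) (n : ℕ) (idx : V → ℕ)
    (hidx : ∀ v, 2 ≤ G.degree v → 1 ≤ idx v ∧ idx v ≤ n)
    (hinj : ∀ u v, 2 ≤ G.degree u → 2 ≤ G.degree v → idx u = idx v → u = v)
    (hsurj : ∀ k, 1 ≤ k → k ≤ n → ∃ v, 2 ≤ G.degree v ∧ idx v = k)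
    (hadj : ∀ u v, 2 ≤ G.degree u → 2 ≤ G.degree v →
      (G.Adj u v ↔ idx u + 1 = idx v ∨ idx v + 1 = idx u))
    (hleaf : ∀ v, G.degree v < 2 → ∃ b, 2 ≤ G.degree b ∧ G.Adj v b) :
    Nonempty (G ↪g doubleComb) := by
  classical
  have hslot : ∀ b, 2 ≤ G.degree b → ∃ g : V → ℕ × SignType,
      Set.InjOn g {v | G.Adj b v ∧ G.degree v < 2} ∧
      ∀ v, G.Adj b v → G.degree v < 2 →
        ((g v).1 = idx b ∧ (g v).2 ≠ 0) ∨
        ((g v).2 = 0 ∧ (((g v).1 = 0 ∧ idx b = 1) ∨ ((g v).1 = n + 1 ∧ idx b = n))) := by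
    intro b hb
    let spine := (G.neighborFinset b).filter (fun v => 2 ≤ G.degree v)
    let leaves := (G.neighborFinset b).filter (fun v => ¬ 2 ≤ G.degree v)
    let nbrs : Finset (ℕ × SignType) := {(idx b, 1), (idx b, -1), (idx b - 1, 0), (idx b + 1, 0)}
    have hnbrs : nbrs.card = 4 := by
      have := hidx b hb
      have h1 : (1 : SignType) ≠ -1 := by decide
      have h2 : idx b - 1 ≠ idx b + 1 := by omega
      simp [nbrs, h1, h2]
    have hcard : leaves.card ≤ (nbrs \ spine.image fun v => (idx v, 0)).card := by
      have h1 : spine.card + leaves.card = G.degree b :=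
        Finset.card_filter_add_card_filter_not _
      have h2 := Finset.le_card_sdiff (spine.image fun v => (idx v, (0 : SignType))) nbrs
      have h3 : (spine.image fun v => (idx v, (0 : SignType))).card ≤ spine.card :=
        Finset.card_image_le
      have := hdeg b
      omega
    obtain ⟨g⟩ : Nonempty (leaves ↪ ↥(nbrs \ spine.image fun v => (idx v, (0 : SignType)))) :=
      Function.Embedding.nonempty_of_card_le (by simpa only [Fintype.card_coe] using hcard)
    have hmem : ∀ v, G.Adj b v → G.degree v < 2 → v ∈ leaves := fun v hv hv' => by
      simpa [leaves, hv] using Nat.le_of_lt_succ hv'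
    refine ⟨fun v => if hv : v ∈ leaves then (g ⟨v, hv⟩ : ℕ × SignType) else (0, 0), ?_, ?_⟩
    · rintro u ⟨hbu, hu⟩ v ⟨hbv, hv⟩ huv
      simp only [hmem u hbu hu, hmem v hbv hv, dif_pos] at huv
      simpa using g.injective (Subtype.ext huv)
    · intro v hbv hv
      simp only [hmem v hbv hv, dif_pos]
      obtain ⟨h1, h2⟩ := Finset.mem_sdiff.1 (g ⟨v, hmem v hbv hv⟩).2
      generalize (g ⟨v, hmem v hbv hv⟩ : ℕ × SignType) = q at h1 h2
      have hspine : ∀ k, 1 ≤ k → k ≤ n → idx b + 1 = k ∨ k + 1 = idx b → q ≠ (k, 0) := by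
        rintro k hk hkn hbk rfl
        obtain ⟨w, hw, rfl⟩ := hsurj k hk hkn
        exact h2 (Finset.mem_image_of_mem _ (by simp [spine, (hadj b w hb hw).2 hbk, hw]))
      have hib := hidx b hb
      simp only [nbrs, Finset.mem_insert, Finset.mem_singleton] at h1
      rcases h1 with rfl | rfl | rfl | rfl
      · simp
      · simp
      · have := hspine (idx b - 1)
        simp at this ⊢
        omega
      · have := hspine (idx b + 1)
        simp at this ⊢
        omega
  choose! g hginj hg using hslot
  choose! p hp hvp using hleaf
  have hpuniq : ∀ v b, G.degree v < 2 → G.Adj v b → b = p v := fun v b hv hb =>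
    hb.eq_of_degree_le_one (hvp v hv) (by omega)
  let f : V → ℕ × SignType := fun v => if 2 ≤ G.degree v then (idx v, 0) else g (p v) v
  have hf1 : ∀ v, 2 ≤ G.degree v → f v = (idx v, 0) := fun v hv => if_pos hv
  have hf2 : ∀ v, G.degree v < 2 → f v = g (p v) v := fun v hv => if_neg (by omega)
  have hslot : ∀ v, G.degree v < 2 →
      ((f v).1 = idx (p v) ∧ (f v).2 ≠ 0) ∨ ((f v).2 = 0 ∧
        (((f v).1 = 0 ∧ idx (p v) = 1) ∨ ((f v).1 = n + 1 ∧ idx (p v) = n))) := fun v hv => by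
    rw [hf2 v hv]
    exact hg _ (hp v hv) v (hvp v hv).symm hv
  have hfp : ∀ u v, G.degree u < 2 → G.degree v < 2 → idx (p u) = idx (p v) → f u = f v →
      u = v := fun u v hu hv huv h => by
    have hpp := hinj _ _ (hp u hu) (hp v hv) huv
    rw [hf2 u hu, hf2 v hv, ← hpp] at h
    exact hginj _ (hp u hu) ⟨(hvp u hu).symm, hu⟩ ⟨hpp ▸ (hvp v hv).symm, hv⟩ h
  have hmixed : ∀ u v, 2 ≤ G.degree u → G.degree v < 2 →
      f u ≠ f v ∧ (doubleComb.Adj (f u) (f v) ↔ G.Adj u v) := fun u v hu hv => by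
    have hiu := hidx u hu
    have hip := hidx _ (hp v hv)
    have huv : G.Adj u v ↔ idx u = idx (p v) :=
      ⟨fun h => by rw [hpuniq v u hv h.symm],
        fun h => hinj _ _ hu (hp v hv) h ▸ (hvp v hv).symm⟩
    have := hslot v hv
    rw [huv, hf1 u hu]
    generalize f v = q at *
    simp only [doubleComb, ne_eq, Prod.ext_iff]
    grind
  have hleaves : ∀ u v, G.degree u < 2 → G.degree v < 2 →
      (f u = f v → idx (p u) = idx (p v)) ∧ ¬ doubleComb.Adj (f u) (f v) ∧ ¬ G.Adj u v :=
    fun u v hu hv => by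
    have hiu := hidx _ (hp u hu)
    have hiv := hidx _ (hp v hv)
    have h1 := hslot u hu
    have h2 := hslot v hv
    refine ⟨fun h => ?_, ?_, fun h => ?_⟩
    · rw [h] at h1
      grind
    · simp only [doubleComb]
      grind
    · have := hpuniq u v hu h
      have := hp u hu
      grind
  refine ⟨⟨f, fun u v h => ?_⟩, fun {u v} => ?_⟩
  · rcases le_or_gt 2 (G.degree u) with hu | hu <;> rcases le_or_gt 2 (G.degree v) with hv | hv
    · rw [hf1 u hu, hf1 v hv] at h
      exact hinj u v hu hv (congrArg Prod.fst h)
    · exact absurd h (hmixed u v hu hv).1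
    · exact absurd h.symm (hmixed v u hv hu).1
    · exact hfp u v hu hv ((hleaves u v hu hv).1 h) h
  · change doubleComb.Adj (f u) (f v) ↔ G.Adj u v
    rcases le_or_gt 2 (G.degree u) with hu | hu <;> rcases le_or_gt 2 (G.degree v) with hv | hv
    · rw [hf1 u hu, hf1 v hv, hadj u v hu hv]
      simp [doubleComb]
    · exact (hmixed u v hu hv).2
    · rw [doubleComb.adj_comm, G.adj_comm]
      exact (hmixed v u hv hu).2
    · simp [(hleaves u v hu hv).2]

end SimpleGraph

/-- Every caterpillar of maximum degree at most 4 admits a unit disk contact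
representation. -/
theorem caterpillar_maxDegree_four_UDC
    {V : Type*} [Fintype V] (G : SimpleGraph V) [DecidableRel G.Adj]
    (hcat : IsCaterpillar G) (hdeg : ∀ v : V, G.degree v ≤ 4) :
    ∃ d : V → EuclideanSpace ℝ (Fin 2), IsUDC G d := by
  classical
  obtain ⟨htree, n, e, he⟩ := hcat
  have hconn := htree.connected.preconnected
  rcases subsingleton_or_nontrivial V with hV | hV
  · exact ⟨fun _ => 0, fun u v huv => (huv (Subsingleton.elim u v)).elim⟩
  by_cases hlight : ∃ u v, G.Adj u v ∧ G.degree u ≤ 1 ∧ G.degree v ≤ 1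
  · obtain ⟨u, v, huv, hu, hv⟩ := hlight
    have hall := hconn.eq_or_eq_of_adj_of_degree_le_one huv hu hv
    refine exists_isUDC_of_embedding (G := G)
      ⟨⟨fun w => if w = u then (0, 0) else (1, 0), fun a b h => ?_⟩, fun {a b} => ?_⟩
    · have := huv.ne
      rcases hall a with rfl | rfl <;> rcases hall b with rfl | rfl <;> simp_all
    · change doubleComb.Adj (if a = u then (0, 0) else (1, 0)) (if b = u then (0, 0) else (1, 0)) ↔
        G.Adj a b
      have hvu := huv.symm
      rcases hall a with rfl | rfl <;> rcases hall b with rfl | rfl <;>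
        simp [doubleComb, huv, hvu, hvu.ne]
  push Not at hlight
  obtain ⟨f⟩ := G.nonempty_embedding_doubleComb hdeg n
    (fun v => if h : 2 ≤ G.degree v then (e ⟨v, h⟩ : ℕ) + 1 else 0)
    (fun v hv => by simp only [hv, dif_pos]; omega)
    (fun u v hu hv h => by
      simp only [hu, hv, dif_pos, add_left_inj] at h
      simpa using e.injective (Fin.ext h))
    (fun k hk hkn => by
      obtain ⟨⟨v, hv⟩, hvk⟩ := e.surjective ⟨k - 1, by omega⟩
      refine ⟨v, hv, ?_⟩
      have hv' : 2 ≤ G.degree v := hv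
      simp only [hv', dif_pos, hvk]
      omega)
    (fun u v hu hv => by
      have := he ⟨u, hu⟩ ⟨v, hv⟩
      simp only [SimpleGraph.comap_adj, Function.Embedding.subtype_apply] at this
      simp only [hu, hv, dif_pos, this]
      omega)
    (fun v hv => by
      have hpos := hconn.degree_pos_of_nontrivial v
      obtain ⟨b, hb⟩ := (G.degree_pos_iff_exists_adj v).1 hpos
      exact ⟨b, hlight v b hb (by omega), hb⟩)
  exact exists_isUDC_of_embedding f
end

section
/- Let G be a caterpillar with maximum degree at most 5 in which no two adjacent vertices both have degree 5, and let v₁, …, v_m be the vertices of its backbone path in order. Then G admits a unit disk intersection representation d : V(G) → ℝ² (for all distinct vertices u, v, the vertices u and v are adjacent in G if and only if dist(d(u), d(v)) ≤ 2) such that the x-coordinates of d(v₁), …, d(v_m) are strictly increasing. -/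
/-- The kinds of vertices of the host caterpillar attached to one position of its backbone. -/
inductive SlotKind
  | spine
  | down
  | top
  | left
  | right
  deriving DecidableEq

/-- Positions with `five` carry the leaves `down`, `left`, `right`, the others `down`, `top`. -/
def SlotKind.Allowed (five : Prop) : SlotKind → Prop
  | .spine => True
  | .down => True
  | .top => ¬ five
  | .left => five
  | .right => five

/-- Adjacency in the host caterpillar. -/
def HostAdj (p : ℕ) (a : SlotKind) (q : ℕ) (b : SlotKind) : Prop :=
  (a = .spine ∧ b = .spine ∧ (p + 1 = q ∨ q + 1 = p)) ∨ (p = q ∧ (a = .spine ↔ b ≠ .spine))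

lemma HostAdj.comm (p : ℕ) (a : SlotKind) (q : ℕ) (b : SlotKind) :
    HostAdj p a q b ↔ HostAdj q b p a := by
  unfold HostAdj; grind

noncomputable section

/-- The unit complex number of argument `t`. -/
def cis (t : ℝ) : ℂ := Complex.exp (t * Complex.I)

lemma cis_re (t : ℝ) : (cis t).re = Real.cos t := Complex.exp_ofReal_mul_I_re t

lemma cis_im (t : ℝ) : (cis t).im = Real.sin t := Complex.exp_ofReal_mul_I_im t

lemma norm_cis (t : ℝ) : ‖cis t‖ = 1 := Complex.norm_exp_ofReal_mul_I t

lemma re_cis_mul_cis (t x : ℝ) : (cis t * cis x).re = Real.cos (t + x) := by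
  rw [Complex.mul_re, cis_re, cis_re, cis_im, cis_im, Real.cos_add]

lemma two_lt_norm_of_re_cis_mul (t : ℝ) {z : ℂ} (h : 2 < (cis t * z).re) : 2 < ‖z‖ := by
  have := Complex.re_le_norm (cis t * z)
  rw [norm_mul, norm_cis, one_mul] at this
  linarith

lemma two_lt_norm_of_re {z : ℂ} (h : 2 < z.re) : 2 < ‖z‖ :=
  h.trans_le (Complex.re_le_norm z)

lemma two_lt_norm_of_normSq {z : ℂ} (h : 4 < Complex.normSq z) : 2 < ‖z‖ := by
  rw [Complex.normSq_eq_norm_sq] at h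
  nlinarith [norm_nonneg z]

lemma two_lt_norm_of_sq {z : ℂ} (h : 4 < z.re ^ 2 + z.im ^ 2) : 2 < ‖z‖ := by
  apply two_lt_norm_of_normSq
  rw [Complex.normSq_apply]
  linarith

lemma normSq_cis_add_cis_add_cis (a b c x y z : ℝ) :
    Complex.normSq (a * cis x + b * cis y + c * cis z) =
      a ^ 2 + b ^ 2 + c ^ 2 + 2 * a * b * Real.cos (x - y) + 2 * a * c * Real.cos (x - z)
        + 2 * b * c * Real.cos (y - z) := by
  simp only [Complex.normSq_apply, Complex.add_re, Complex.add_im, Complex.re_ofReal_mul,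
    Complex.im_ofReal_mul, cis_re, cis_im, Real.cos_sub]
  linear_combination a ^ 2 * Real.sin_sq_add_cos_sq x + b ^ 2 * Real.sin_sq_add_cos_sq y +
    c ^ 2 * Real.sin_sq_add_cos_sq z

/-- The distance of a `top` leaf from its backbone vertex, for turning angle `2 * φ`. -/
def topRadius (φ : ℝ) : ℝ := 1 - 2 * Real.cos (Real.pi / 3 + φ / 2)

/-- The backbone: a polygonal arc with edges of length `2` and turning angle `2 * φ`. -/
def spinePos (φ : ℝ) (p : ℕ) : ℂ :=
  ∑ k ∈ Finset.range p, (2 : ℝ) * cis (-(2 * k + 1) * φ)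

/-- The position of a vertex relative to its backbone vertex. -/
def slotOffset (φ : ℝ) (p : ℕ) : SlotKind → ℂ
  | .spine => 0
  | .down => (2 : ℝ) * cis (p * φ - Real.pi / 2)
  | .top => topRadius φ * cis (Real.pi / 2 - 2 * p * φ)
  | .left => (2 : ℝ) * cis (2 * Real.pi / 3 + φ / 2 - 2 * p * φ)
  | .right => (2 : ℝ) * cis (Real.pi / 3 - φ / 2 - 2 * p * φ)

/-- The position of a vertex of the host caterpillar. -/
def slotPos (φ : ℝ) (p : ℕ) (a : SlotKind) : ℂ := spinePos φ p + slotOffset φ p a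

lemma spinePos_succ (φ : ℝ) (p : ℕ) :
    spinePos φ (p + 1) = spinePos φ p + (2 : ℝ) * cis (-(2 * p + 1) * φ) :=
  Finset.sum_range_succ _ _

lemma spinePos_mono_re {φ : ℝ} (hφ : 0 < φ) {p q : ℕ} (hpq : p ≤ q)
    (hq : (q + 1) * φ ≤ 1 / 1000) :
    1.98 * ((q : ℝ) - p) ≤ (spinePos φ q - spinePos φ p).re ∧
      |(spinePos φ q - spinePos φ p).im| ≤ 0.02 * ((q : ℝ) - p) := by
  induction q, hpq using Nat.le_induction with
  | base => simp
  | succ q hpq ih =>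
    push_cast at hq
    obtain ⟨hre, him⟩ := ih (by nlinarith)
    have hq0 : (0 : ℝ) ≤ q * φ := by positivity
    have hcos : |Real.cos (-(2 * q + 1) * φ) - Real.cos 0| ≤ |-(2 * q + 1) * φ - 0| :=
      Real.abs_cos_sub_cos_le _ _
    have hsin : |Real.sin (-(2 * q + 1) * φ) - Real.sin 0| ≤ |-(2 * q + 1) * φ - 0| :=
      Real.abs_sin_sub_sin_le _ _
    have habs : |-(2 * q + 1) * φ - 0| ≤ 0.01 := by
      rw [abs_le]; constructor <;> nlinarith
    rw [Real.cos_zero] at hcos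
    rw [Real.sin_zero, sub_zero] at hsin
    rw [spinePos_succ, add_sub_right_comm, Complex.add_re, Complex.add_im, Complex.re_ofReal_mul,
      Complex.im_ofReal_mul, cis_re, cis_im]
    rw [abs_le] at hcos hsin him ⊢
    push_cast
    norm_num at *
    refine ⟨?_, ?_, ?_⟩ <;> linarith

lemma cos_pi_div_three_add_lt {x : ℝ} (h₀ : 0 < x) (h₁ : x ≤ 1 / 100) :
    Real.cos (Real.pi / 3 + x) < 1 / 2 := by
  rw [← Real.cos_pi_div_three]
  have := Real.pi_gt_three
  exact Real.cos_lt_cos_of_nonneg_of_le_pi (by positivity) (by linarith) (by linarith)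

lemma topRadius_bounds {φ : ℝ} (hφ : 0 < φ) (hφ' : φ ≤ 1 / 1000) :
    0 < topRadius φ ∧ topRadius φ ≤ 1 / 1000 := by
  have h := Real.abs_cos_sub_cos_le (Real.pi / 3 + φ / 2) (Real.pi / 3)
  have h' := cos_pi_div_three_add_lt (half_pos hφ) (by linarith)
  rw [add_sub_cancel_left, abs_of_pos (half_pos hφ), Real.cos_pi_div_three, abs_le] at h
  unfold topRadius
  constructor <;> linarith [h.1]

lemma sin_pi_div_three_bounds :
    1.73 < 2 * Real.sin (Real.pi / 3) ∧ 2 * Real.sin (Real.pi / 3) < 1.74 := by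
  rw [Real.sin_pi_div_three, mul_div_cancel₀ _ two_ne_zero]
  constructor
  · exact Real.lt_sqrt_of_sq_lt (by norm_num)
  · rw [Real.sqrt_lt' (by norm_num)]; norm_num

section Bounds

variable {φ : ℝ} {p : ℕ}

lemma cis_near {x y : ℝ} (h : |x - y| ≤ 0.005) :
    |(cis x).re - Real.cos y| ≤ 0.005 ∧ |(cis x).im - Real.sin y| ≤ 0.005 := by
  rw [cis_re, cis_im]
  exact ⟨(Real.abs_cos_sub_cos_le x y).trans h, (Real.abs_sin_sub_sin_le x y).trans h⟩

lemma down_bounds (hφ : 0 < φ) (hp : (p + 1) * φ ≤ 1 / 1000) :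
    |(slotOffset φ p .down).re| ≤ 0.02 ∧ |(slotOffset φ p .down).im + 2| ≤ 0.02 := by
  have h0 : (0 : ℝ) ≤ p * φ := by positivity
  have h := cis_near (x := p * φ - Real.pi / 2) (y := -(Real.pi / 2))
    (by rw [abs_le]; constructor <;> nlinarith)
  rw [Real.cos_neg, Real.sin_neg, Real.cos_pi_div_two, Real.sin_pi_div_two] at h
  simp only [slotOffset, Complex.re_ofReal_mul, Complex.im_ofReal_mul]
  simp only [abs_le] at h ⊢
  refine ⟨⟨?_, ?_⟩, ?_, ?_⟩ <;> linarith [h.1.1, h.1.2, h.2.1, h.2.2]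

lemma top_bounds (hφ : 0 < φ) (hp : (p + 1) * φ ≤ 1 / 1000) :
    |(slotOffset φ p .top).re| ≤ 0.02 ∧ |(slotOffset φ p .top).im| ≤ 0.02 := by
  have h0 : (0 : ℝ) ≤ p * φ := by positivity
  obtain ⟨hr, hr'⟩ := topRadius_bounds hφ (by linarith)
  have hn : ‖slotOffset φ p .top‖ ≤ 0.02 := by
    rw [slotOffset, norm_mul, norm_cis, Complex.norm_of_nonneg hr.le]
    linarith
  exact ⟨(Complex.abs_re_le_norm _).trans hn, (Complex.abs_im_le_norm _).trans hn⟩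

lemma right_bounds (hφ : 0 < φ) (hp : (p + 1) * φ ≤ 1 / 1000) :
    |(slotOffset φ p .right).re - 1| ≤ 0.02 ∧ |(slotOffset φ p .right).im - 1.735| ≤ 0.02 := by
  have h0 : (0 : ℝ) ≤ p * φ := by positivity
  have h := cis_near (x := Real.pi / 3 - φ / 2 - 2 * p * φ) (y := Real.pi / 3)
    (by rw [abs_le]; constructor <;> linarith)
  have hs := sin_pi_div_three_bounds
  rw [Real.cos_pi_div_three] at h
  simp only [slotOffset, Complex.re_ofReal_mul, Complex.im_ofReal_mul]
  simp only [abs_le] at h ⊢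
  refine ⟨⟨?_, ?_⟩, ?_, ?_⟩ <;> linarith [h.1.1, h.1.2, h.2.1, h.2.2, hs.1, hs.2]

lemma cos_two_pi_div_three_add (x : ℝ) :
    Real.cos (2 * Real.pi / 3 + x) = -Real.cos (Real.pi / 3 - x) := by
  rw [← Real.cos_pi_sub]; congr 1; ring

lemma left_bounds (hφ : 0 < φ) (hp : (p + 1) * φ ≤ 1 / 1000) :
    |(slotOffset φ p .left).re + 1| ≤ 0.02 ∧ |(slotOffset φ p .left).im - 1.735| ≤ 0.02 := by
  have h0 : (0 : ℝ) ≤ p * φ := by positivity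
  have h := cis_near (x := 2 * Real.pi / 3 + φ / 2 - 2 * p * φ) (y := Real.pi - Real.pi / 3)
    (by rw [abs_le]; constructor <;> linarith)
  have hs := sin_pi_div_three_bounds
  rw [Real.cos_pi_sub, Real.sin_pi_sub, Real.cos_pi_div_three] at h
  simp only [slotOffset, Complex.re_ofReal_mul, Complex.im_ofReal_mul]
  simp only [abs_le] at h ⊢
  refine ⟨⟨?_, ?_⟩, ?_, ?_⟩ <;> linarith [h.1.1, h.1.2, h.2.1, h.2.2, hs.1, hs.2]

lemma slotOffset_bounds (hφ : 0 < φ) (hp : (p + 1) * φ ≤ 1 / 1000) (a : SlotKind) :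
    |(slotOffset φ p a).re| ≤ 1.02 ∧ (a ≠ .right → (slotOffset φ p a).re ≤ 0.02) ∧
      (a ≠ .left → -0.02 ≤ (slotOffset φ p a).re) ∧
      (a ≠ .down → -0.02 ≤ (slotOffset φ p a).im) := by
  have h₁ := down_bounds hφ hp
  have h₂ := top_bounds hφ hp
  have h₃ := left_bounds hφ hp
  have h₄ := right_bounds hφ hp
  simp only [abs_le] at *
  cases a
  case spine => simp [slotOffset]; norm_num
  all_goals
    refine ⟨⟨?_, ?_⟩, ?_, ?_, ?_⟩ <;> intros <;> first | contradiction | linarith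

end Bounds

lemma slotPos_sub (φ : ℝ) (p q : ℕ) (a b : SlotKind) :
    slotPos φ q b - slotPos φ p a =
      (spinePos φ q - spinePos φ p) + (slotOffset φ q b - slotOffset φ p a) := by
  unfold slotPos; ring

lemma slotPos_succ_sub (φ : ℝ) (p : ℕ) (a b : SlotKind) :
    slotPos φ (p + 1) b - slotPos φ p a =
      (2 : ℝ) * cis (-(2 * p + 1) * φ) + (slotOffset φ (p + 1) b - slotOffset φ p a) := by
  rw [slotPos_sub, spinePos_succ, add_sub_cancel_left]

lemma slotPos_self_sub (φ : ℝ) (p : ℕ) (a b : SlotKind) :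
    slotPos φ p b - slotPos φ p a = slotOffset φ p b - slotOffset φ p a := by
  rw [slotPos_sub, sub_self, zero_add]

section Separation

variable {φ : ℝ} {p q : ℕ}

lemma two_lt_norm_of_far (hφ : 0 < φ) (hpq : p + 2 ≤ q) (hq : (q + 1) * φ ≤ 1 / 1000)
    {a b : SlotKind} (h : a = .right → b = .left → p + 3 ≤ q) :
    2 < ‖slotPos φ q b - slotPos φ p a‖ := by
  have hpq' : (p : ℝ) + 2 ≤ q := by exact_mod_cast hpq
  obtain ⟨h₁, -⟩ := spinePos_mono_re hφ (by omega : p ≤ q) hq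
  obtain ⟨ha, ha', -⟩ := slotOffset_bounds hφ (p := p) (by nlinarith) a
  obtain ⟨hb, -, hb', -⟩ := slotOffset_bounds hφ hq b
  rw [abs_le] at ha hb
  apply two_lt_norm_of_re
  rw [slotPos_sub, Complex.add_re, Complex.sub_re (slotOffset _ _ _)]
  by_cases har : a = .right
  · by_cases hbl : b = .left
    · have : (p : ℝ) + 3 ≤ q := by exact_mod_cast h har hbl
      linarith [ha.2, hb.1]
    · linarith [ha.2, hb' hbl]
  · linarith [ha' har, hb.1]

lemma re_im_succ_bounds (hφ : 0 < φ) (hp : ((p + 1 : ℕ) + 1) * φ ≤ 1 / 1000) (a b : SlotKind) :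
    1.98 + (slotOffset φ (p + 1) b).re - (slotOffset φ p a).re ≤
        (slotPos φ (p + 1) b - slotPos φ p a).re ∧
      |(slotPos φ (p + 1) b - slotPos φ p a).im -
        ((slotOffset φ (p + 1) b).im - (slotOffset φ p a).im)| ≤ 0.02 := by
  obtain ⟨h₁, h₂⟩ := spinePos_mono_re hφ (Nat.le_succ p) hp
  rw [slotPos_sub]
  push_cast at *
  simp only [Complex.add_re, Complex.add_im, Complex.sub_re, Complex.sub_im] at *
  constructor
  · linarith
  · rw [add_sub_cancel_right]; linarith

lemma two_lt_norm_down_succ (hφ : 0 < φ) (hp : ((p + 1 : ℕ) + 1) * φ ≤ 1 / 1000) {b : SlotKind}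
    (hb : b ≠ .down) : 2 < ‖slotPos φ (p + 1) b - slotPos φ p .down‖ := by
  obtain ⟨h₁, h₂⟩ := re_im_succ_bounds hφ hp .down b
  have hp' : ((p : ℝ) + 1) * φ ≤ 1 / 1000 := by push_cast at hp; nlinarith
  obtain ⟨h₃, h₄⟩ := down_bounds hφ hp'
  obtain ⟨h₅, -, h₆, h₇⟩ := slotOffset_bounds hφ hp b
  have h₇ := h₇ hb
  have h₈ := left_bounds hφ hp
  simp only [abs_le] at *
  apply two_lt_norm_of_sq
  by_cases hbl : b = .left
  · subst hbl
    nlinarith [h₁, h₂.1, h₃.2, h₄.2, h₈.2.1]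
  · have := h₆ hbl
    nlinarith [h₁, h₂.1, h₃.2, h₄.2]

lemma two_lt_norm_succ_down (hφ : 0 < φ) (hp : ((p + 1 : ℕ) + 1) * φ ≤ 1 / 1000) {a : SlotKind}
    (ha : a ≠ .down) : 2 < ‖slotPos φ (p + 1) .down - slotPos φ p a‖ := by
  obtain ⟨h₁, h₂⟩ := re_im_succ_bounds hφ hp a .down
  have hp' : ((p : ℝ) + 1) * φ ≤ 1 / 1000 := by push_cast at hp; nlinarith
  obtain ⟨h₃, h₄⟩ := down_bounds hφ hp
  obtain ⟨h₅, h₆, -, h₇⟩ := slotOffset_bounds hφ hp' a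
  have h₇ := h₇ ha
  have h₈ := right_bounds hφ hp'
  simp only [abs_le] at *
  apply two_lt_norm_of_sq
  by_cases har : a = .right
  · subst har
    nlinarith [h₁, h₂.2, h₃.1, h₄.2, h₈.2.1]
  · have := h₆ har
    nlinarith [h₁, h₂.2, h₃.1, h₄.2]

lemma two_lt_norm_left_succ (hφ : 0 < φ) (hp : ((p + 1 : ℕ) + 1) * φ ≤ 1 / 1000) {b : SlotKind}
    (hb : b ≠ .left) : 2 < ‖slotPos φ (p + 1) b - slotPos φ p .left‖ := by
  obtain ⟨h₁, -⟩ := re_im_succ_bounds hφ hp .left b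
  have hp' : ((p : ℝ) + 1) * φ ≤ 1 / 1000 := by push_cast at hp; nlinarith
  obtain ⟨h₃, -⟩ := left_bounds hφ hp'
  obtain ⟨-, -, h₆, -⟩ := slotOffset_bounds hφ hp b
  have h₆ := h₆ hb
  rw [abs_le] at h₃
  exact two_lt_norm_of_re (by linarith)

lemma two_lt_norm_succ_right (hφ : 0 < φ) (hp : ((p + 1 : ℕ) + 1) * φ ≤ 1 / 1000) {a : SlotKind}
    (ha : a ≠ .right) : 2 < ‖slotPos φ (p + 1) .right - slotPos φ p a‖ := by
  obtain ⟨h₁, -⟩ := re_im_succ_bounds hφ hp a .right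
  have hp' : ((p : ℝ) + 1) * φ ≤ 1 / 1000 := by push_cast at hp; nlinarith
  obtain ⟨h₃, -⟩ := right_bounds hφ hp
  obtain ⟨-, h₆, -, -⟩ := slotOffset_bounds hφ hp' a
  have h₆ := h₆ ha
  rw [abs_le] at h₃
  exact two_lt_norm_of_re (by linarith)

lemma sin_pos_of_small (hφ : 0 < φ) (hφ' : φ ≤ 1 / 1000) : 0 < Real.sin φ :=
  Real.sin_pos_of_pos_of_lt_pi hφ (by linarith [Real.pi_gt_three])

lemma two_lt_norm_spine_sub_top (hφ : 0 < φ) (hφ' : φ ≤ 1 / 1000) :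
    2 < ‖slotPos φ (p + 1) .spine - slotPos φ p .top‖ := by
  obtain ⟨hr, -⟩ := topRadius_bounds hφ hφ'
  have key := normSq_cis_add_cis_add_cis 2 (-topRadius φ) 0 (-(2 * p + 1) * φ)
    (Real.pi / 2 - 2 * p * φ) 0
  rw [show -(2 * p + 1) * φ - (Real.pi / 2 - 2 * p * φ) = -(φ + Real.pi / 2) by ring,
    Real.cos_neg, Real.cos_add_pi_div_two] at key
  apply two_lt_norm_of_normSq
  rw [slotPos_succ_sub]
  simp only [slotOffset]
  rw [show (2 : ℝ) * cis (-(2 * p + 1) * φ) + (0 - topRadius φ * cis (Real.pi / 2 - 2 * p * φ)) =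
    (2 : ℝ) * cis (-(2 * p + 1) * φ) + (-topRadius φ : ℝ) * cis (Real.pi / 2 - 2 * p * φ) +
      (0 : ℝ) * cis 0 by push_cast; ring, key]
  nlinarith [mul_pos hr (sin_pos_of_small hφ hφ')]

lemma two_lt_norm_top_sub_spine (hφ : 0 < φ) (hφ' : φ ≤ 1 / 1000) :
    2 < ‖slotPos φ (p + 1) .top - slotPos φ p .spine‖ := by
  obtain ⟨hr, -⟩ := topRadius_bounds hφ hφ'
  have key := normSq_cis_add_cis_add_cis 2 (topRadius φ) 0 (-(2 * p + 1) * φ)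
    (Real.pi / 2 - 2 * (p + 1 : ℕ) * φ) 0
  rw [show -(2 * p + 1) * φ - (Real.pi / 2 - 2 * (p + 1 : ℕ) * φ) = φ - Real.pi / 2 by
    push_cast; ring, Real.cos_sub_pi_div_two] at key
  apply two_lt_norm_of_normSq
  rw [slotPos_succ_sub]
  simp only [slotOffset]
  rw [show ∀ x y : ℂ, x + (y - 0) = x + y + (0 : ℝ) * cis 0 by intros; push_cast; ring, key]
  nlinarith [mul_pos hr (sin_pos_of_small hφ hφ')]

lemma two_lt_norm_top_sub_top (hφ : 0 < φ) (hφ' : φ ≤ 1 / 1000) :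
    2 < ‖slotPos φ (p + 1) .top - slotPos φ p .top‖ := by
  obtain ⟨hr, -⟩ := topRadius_bounds hφ hφ'
  apply two_lt_norm_of_re_cis_mul ((2 * p + 1) * φ)
  rw [slotPos_succ_sub]
  simp only [slotOffset, mul_add, mul_sub, mul_left_comm (cis _), Complex.add_re, Complex.sub_re,
    Complex.re_ofReal_mul, re_cis_mul_cis]
  rw [show (2 * p + 1) * φ + -(2 * p + 1) * φ = 0 by ring,
    show (2 * p + 1) * φ + (Real.pi / 2 - 2 * (p + 1 : ℕ) * φ) = -(φ - Real.pi / 2) by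
      push_cast; ring,
    show (2 * p + 1) * φ + (Real.pi / 2 - 2 * p * φ) = φ + Real.pi / 2 by ring,
    Real.cos_zero, Real.cos_neg, Real.cos_sub_pi_div_two, Real.cos_add_pi_div_two]
  nlinarith [mul_pos hr (sin_pos_of_small hφ hφ')]

lemma two_lt_norm_down_sub_down (hφ : 0 < φ) (hp : (p + 1) * φ ≤ 1 / 1000) :
    2 < ‖slotPos φ (p + 1) .down - slotPos φ p .down‖ := by
  have h0 : (0 : ℝ) ≤ p * φ := by positivity
  have hsin : Real.sin ((3 * p + 1) * φ) < Real.sin ((3 * p + 2) * φ) := by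
    have := Real.pi_gt_three
    apply Real.sin_lt_sin_of_lt_of_le_pi_div_two <;> nlinarith
  apply two_lt_norm_of_re_cis_mul ((2 * p + 1) * φ)
  rw [slotPos_succ_sub]
  simp only [slotOffset, mul_add, mul_sub, mul_left_comm (cis _), Complex.add_re, Complex.sub_re,
    Complex.re_ofReal_mul, re_cis_mul_cis]
  rw [show (2 * p + 1) * φ + -(2 * p + 1) * φ = 0 by ring,
    show (2 * p + 1) * φ + ((p + 1 : ℕ) * φ - Real.pi / 2) = (3 * p + 2) * φ - Real.pi / 2 by
      push_cast; ring,
    show (2 * p + 1) * φ + (p * φ - Real.pi / 2) = (3 * p + 1) * φ - Real.pi / 2 by ring,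
    Real.cos_zero, Real.cos_sub_pi_div_two, Real.cos_sub_pi_div_two]
  linarith

lemma two_lt_norm_spine_sub_right (hφ : 0 < φ) (hφ' : φ ≤ 1 / 1000) :
    2 < ‖slotPos φ (p + 1) .spine - slotPos φ p .right‖ := by
  have hcos := cos_pi_div_three_add_lt (half_pos hφ) (by linarith)
  have key := normSq_cis_add_cis_add_cis 2 (-2) 0 (-(2 * p + 1) * φ)
    (Real.pi / 3 - φ / 2 - 2 * p * φ) 0
  rw [show -(2 * p + 1) * φ - (Real.pi / 3 - φ / 2 - 2 * p * φ) = -(Real.pi / 3 + φ / 2) by ring,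
    Real.cos_neg] at key
  apply two_lt_norm_of_normSq
  rw [slotPos_succ_sub]
  simp only [slotOffset]
  rw [show ∀ x y : ℂ, x + (0 - (2 : ℝ) * y) = x + (-2 : ℝ) * y + (0 : ℝ) * cis 0 by
    intros; push_cast; ring, key]
  linarith

lemma two_lt_norm_left_sub_spine (hφ : 0 < φ) (hφ' : φ ≤ 1 / 1000) :
    2 < ‖slotPos φ (p + 1) .left - slotPos φ p .spine‖ := by
  have hcos := cos_pi_div_three_add_lt (half_pos hφ) (by linarith)
  have key := normSq_cis_add_cis_add_cis 2 2 0 (-(2 * p + 1) * φ)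
    (2 * Real.pi / 3 + φ / 2 - 2 * (p + 1 : ℕ) * φ) 0
  rw [show -(2 * p + 1) * φ - (2 * Real.pi / 3 + φ / 2 - 2 * (p + 1 : ℕ) * φ) =
      -(2 * Real.pi / 3 + -(φ / 2)) by push_cast; ring,
    Real.cos_neg, cos_two_pi_div_three_add, sub_neg_eq_add] at key
  apply two_lt_norm_of_normSq
  rw [slotPos_succ_sub]
  simp only [slotOffset]
  rw [show ∀ x y : ℂ, x + (y - 0) = x + y + (0 : ℝ) * cis 0 by intros; push_cast; ring, key]
  linarith

lemma two_lt_norm_top_sub_right (hφ : 0 < φ) (hφ' : φ ≤ 1 / 1000) :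
    2 < ‖slotPos φ (p + 1) .top - slotPos φ p .right‖ := by
  obtain ⟨hr, -⟩ := topRadius_bounds hφ hφ'
  have key := normSq_cis_add_cis_add_cis 2 (-2) (topRadius φ) (-(2 * p + 1) * φ)
    (Real.pi / 3 - φ / 2 - 2 * p * φ) (Real.pi / 2 - 2 * (p + 1 : ℕ) * φ)
  have hle := Real.cos_le_one
    (Real.pi / 3 - φ / 2 - 2 * p * φ - (Real.pi / 2 - 2 * (p + 1 : ℕ) * φ))
  rw [show -(2 * p + 1) * φ - (Real.pi / 3 - φ / 2 - 2 * p * φ) = -(Real.pi / 3 + φ / 2) by ring,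
    Real.cos_neg,
    show -(2 * p + 1) * φ - (Real.pi / 2 - 2 * (p + 1 : ℕ) * φ) = φ - Real.pi / 2 by
      push_cast; ring, Real.cos_sub_pi_div_two] at key
  apply two_lt_norm_of_normSq
  rw [slotPos_succ_sub]
  simp only [slotOffset]
  rw [show ∀ x y z : ℂ, x + (y - (2 : ℝ) * z) = x + (-2 : ℝ) * z + y by
    intros; push_cast; ring, key]
  have hdef : topRadius φ = 1 - 2 * Real.cos (Real.pi / 3 + φ / 2) := rfl
  nlinarith [mul_pos hr (sin_pos_of_small hφ hφ'), mul_le_mul_of_nonneg_left hle hr.le]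

lemma two_lt_norm_left_sub_top (hφ : 0 < φ) (hφ' : φ ≤ 1 / 1000) :
    2 < ‖slotPos φ (p + 1) .left - slotPos φ p .top‖ := by
  obtain ⟨hr, -⟩ := topRadius_bounds hφ hφ'
  have key := normSq_cis_add_cis_add_cis 2 2 (-topRadius φ) (-(2 * p + 1) * φ)
    (2 * Real.pi / 3 + φ / 2 - 2 * (p + 1 : ℕ) * φ) (Real.pi / 2 - 2 * p * φ)
  have hle := Real.cos_le_one
    (2 * Real.pi / 3 + φ / 2 - 2 * (p + 1 : ℕ) * φ - (Real.pi / 2 - 2 * p * φ))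
  rw [show -(2 * p + 1) * φ - (2 * Real.pi / 3 + φ / 2 - 2 * (p + 1 : ℕ) * φ) =
      -(2 * Real.pi / 3 + -(φ / 2)) by push_cast; ring,
    Real.cos_neg, cos_two_pi_div_three_add, sub_neg_eq_add,
    show -(2 * p + 1) * φ - (Real.pi / 2 - 2 * p * φ) = -(φ + Real.pi / 2) by ring,
    Real.cos_neg, Real.cos_add_pi_div_two] at key
  apply two_lt_norm_of_normSq
  rw [slotPos_succ_sub]
  simp only [slotOffset]
  rw [show ∀ x y z : ℂ, x + (y - topRadius φ * z) = x + y + (-topRadius φ : ℝ) * z by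
    intros; push_cast; ring, key]
  have hdef : topRadius φ = 1 - 2 * Real.cos (Real.pi / 3 + φ / 2) := rfl
  nlinarith [mul_pos hr (sin_pos_of_small hφ hφ'), mul_le_mul_of_nonneg_left hle hr.le]

lemma two_lt_norm_left_sub_right (hφ : 0 < φ) (hφ' : φ ≤ 1 / 1000) :
    2 < ‖slotPos φ (p + 2) .left - slotPos φ p .right‖ := by
  have hπ := Real.pi_gt_three
  have h₁ : 1 / 2 < Real.sin (Real.pi / 6 + 5 * φ / 4) := by
    rw [← Real.sin_pi_div_six]
    apply Real.sin_lt_sin_of_lt_of_le_pi_div_two <;> linarith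
  have h₂ : 1 / 2 < Real.sin (Real.pi / 6 + φ / 4) := by
    rw [← Real.sin_pi_div_six]
    apply Real.sin_lt_sin_of_lt_of_le_pi_div_two <;> linarith
  have h₃ := Real.cos_sub_cos φ (Real.pi / 3 + 3 * φ / 2)
  rw [show (φ + (Real.pi / 3 + 3 * φ / 2)) / 2 = Real.pi / 6 + 5 * φ / 4 by ring,
    show (φ - (Real.pi / 3 + 3 * φ / 2)) / 2 = -(Real.pi / 6 + φ / 4) by ring,
    Real.sin_neg] at h₃
  apply two_lt_norm_of_re_cis_mul ((2 * p + 2) * φ)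
  rw [slotPos_sub, spinePos_succ, spinePos_succ]
  simp only [slotOffset, mul_add, mul_sub, mul_left_comm (cis _), Complex.add_re, Complex.sub_re,
    Complex.re_ofReal_mul, re_cis_mul_cis]
  rw [show (2 * p + 2) * φ + -(2 * p + 1) * φ = φ by ring,
    show (2 * p + 2) * φ + -(2 * (p + 1 : ℕ) + 1) * φ = -φ by push_cast; ring, Real.cos_neg,
    show (2 * p + 2) * φ + (2 * Real.pi / 3 + φ / 2 - 2 * (p + 2 : ℕ) * φ) =
      2 * Real.pi / 3 + -(3 * φ / 2) by push_cast; ring, cos_two_pi_div_three_add, sub_neg_eq_add,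
    show (2 * p + 2) * φ + (Real.pi / 3 - φ / 2 - 2 * p * φ) = Real.pi / 3 + 3 * φ / 2 by ring]
  nlinarith

lemma two_lt_norm_right_sub_left (hφ : 0 < φ) (hφ' : φ ≤ 1 / 1000) :
    2 < ‖slotPos φ p .right - slotPos φ p .left‖ := by
  have hcos : 1 / 2 < Real.cos (Real.pi / 3 - φ / 2) := by
    rw [← Real.cos_pi_div_three]
    have := Real.pi_gt_three
    apply Real.cos_lt_cos_of_nonneg_of_le_pi <;> linarith
  apply two_lt_norm_of_re_cis_mul (2 * p * φ)
  rw [slotPos_self_sub]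
  simp only [slotOffset, mul_sub, mul_left_comm (cis _), Complex.sub_re,
    Complex.re_ofReal_mul, re_cis_mul_cis]
  rw [show 2 * p * φ + (2 * Real.pi / 3 + φ / 2 - 2 * p * φ) = 2 * Real.pi / 3 + φ / 2 by ring,
    cos_two_pi_div_three_add,
    show 2 * p * φ + (Real.pi / 3 - φ / 2 - 2 * p * φ) = Real.pi / 3 - φ / 2 by ring]
  linarith

lemma two_lt_norm_top_sub_down (hφ : 0 < φ) (hp : (p + 1) * φ ≤ 1 / 1000) :
    2 < ‖slotPos φ p .top - slotPos φ p .down‖ := by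
  have h0 : (0 : ℝ) ≤ p * φ := by positivity
  obtain ⟨hr, -⟩ := topRadius_bounds hφ (by linarith)
  have hcos : 0 < Real.cos (3 * p * φ) := by
    have := Real.pi_gt_three
    apply Real.cos_pos_of_mem_Ioo
    constructor <;> linarith
  have key := normSq_cis_add_cis_add_cis (topRadius φ) (-2) 0 (Real.pi / 2 - 2 * p * φ)
    (p * φ - Real.pi / 2) 0
  rw [show Real.pi / 2 - 2 * p * φ - (p * φ - Real.pi / 2) = Real.pi - 3 * p * φ by ring,
    Real.cos_pi_sub] at key
  apply two_lt_norm_of_normSq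
  rw [slotPos_self_sub]
  simp only [slotOffset]
  rw [show ∀ x y : ℂ, x - (2 : ℝ) * y = x + (-2 : ℝ) * y + (0 : ℝ) * cis 0 by
    intros; push_cast; ring, key]
  nlinarith [mul_pos hr hcos]

end Separation

section Placement

variable {φ : ℝ} {p q : ℕ}

lemma two_lt_norm_succ {s : ℕ → Prop} (hs : ¬ (s p ∧ s (p + 1))) (hφ : 0 < φ)
    (hp : ((p + 1 : ℕ) + 1) * φ ≤ 1 / 1000) {a b : SlotKind} (ha : a.Allowed (s p))
    (hb : b.Allowed (s (p + 1))) (hab : ¬ (a = .spine ∧ b = .spine)) :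
    2 < ‖slotPos φ (p + 1) b - slotPos φ p a‖ := by
  have hp' : ((p : ℝ) + 1) * φ ≤ 1 / 1000 := by push_cast at hp; nlinarith
  have hφ' : φ ≤ 1 / 1000 := by nlinarith [mul_nonneg p.cast_nonneg hφ.le]
  cases a with
  | spine =>
    cases b with
    | spine => exact absurd ⟨rfl, rfl⟩ hab
    | down => exact two_lt_norm_succ_down hφ hp (by decide)
    | top => exact two_lt_norm_top_sub_spine hφ hφ'
    | left => exact two_lt_norm_left_sub_spine hφ hφ'
    | right => exact two_lt_norm_succ_right hφ hp (by decide)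
  | down =>
    cases b with
    | spine => exact two_lt_norm_down_succ hφ hp (by decide)
    | down => exact two_lt_norm_down_sub_down hφ hp'
    | top => exact two_lt_norm_down_succ hφ hp (by decide)
    | left => exact two_lt_norm_down_succ hφ hp (by decide)
    | right => exact two_lt_norm_down_succ hφ hp (by decide)
  | top =>
    cases b with
    | spine => exact two_lt_norm_spine_sub_top hφ hφ'
    | down => exact two_lt_norm_succ_down hφ hp (by decide)
    | top => exact two_lt_norm_top_sub_top hφ hφ'
    | left => exact two_lt_norm_left_sub_top hφ hφ'
    | right => exact two_lt_norm_succ_right hφ hp (by decide)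
  | left =>
    cases b with
    | spine => exact two_lt_norm_left_succ hφ hp (by decide)
    | down => exact two_lt_norm_left_succ hφ hp (by decide)
    | top => exact two_lt_norm_left_succ hφ hp (by decide)
    | left => exact (hs ⟨ha, hb⟩).elim
    | right => exact (hs ⟨ha, hb⟩).elim
  | right =>
    cases b with
    | spine => exact two_lt_norm_spine_sub_right hφ hφ'
    | down => exact two_lt_norm_succ_down hφ hp (by decide)
    | top => exact two_lt_norm_top_sub_right hφ hφ'
    | left => exact (hs ⟨ha, hb⟩).elim
    | right => exact (hs ⟨ha, hb⟩).elim

lemma two_lt_norm_self {five : Prop} (hφ : 0 < φ) (hp : (p + 1) * φ ≤ 1 / 1000)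
    {a b : SlotKind} (ha : a.Allowed five) (hb : b.Allowed five) (hab : a ≠ b)
    (ha' : a ≠ .spine) (hb' : b ≠ .spine) : 2 < ‖slotPos φ p b - slotPos φ p a‖ := by
  have hφ' : φ ≤ 1 / 1000 := by nlinarith [mul_nonneg p.cast_nonneg hφ.le]
  have hd := (down_bounds hφ hp).2
  have hl := (left_bounds hφ hp).2
  have hr := (right_bounds hφ hp).2
  rw [abs_le] at hd hl hr
  have hld : 2 < ‖slotPos φ p .left - slotPos φ p .down‖ := by
    apply two_lt_norm_of_sq
    rw [slotPos_self_sub, Complex.sub_im]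
    nlinarith
  have hrd : 2 < ‖slotPos φ p .right - slotPos φ p .down‖ := by
    apply two_lt_norm_of_sq
    rw [slotPos_self_sub, Complex.sub_im]
    nlinarith
  have hrl := two_lt_norm_right_sub_left (p := p) hφ hφ'
  have htd := two_lt_norm_top_sub_down hφ hp
  cases a <;> cases b <;> simp only [SlotKind.Allowed] at ha hb <;>
    first
      | contradiction
      | assumption
      | (rw [norm_sub_rev]; assumption)

lemma norm_slotOffset_le (hφ : 0 < φ) (hφ' : φ ≤ 1 / 1000) (a : SlotKind) :
    ‖slotOffset φ p a‖ ≤ 2 := by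
  obtain ⟨hr, hr'⟩ := topRadius_bounds hφ hφ'
  cases a <;> simp only [slotOffset, norm_zero, norm_mul, norm_cis, Complex.norm_real,
    Real.norm_eq_abs, abs_of_pos hr, abs_two] <;> linarith

lemma hostAdj_iff_norm_le_of_le {s : ℕ → Prop} (hs : ∀ p, ¬ (s p ∧ s (p + 1))) (hφ : 0 < φ)
    (hpq : p ≤ q) (hq : (q + 1) * φ ≤ 1 / 1000) {a b : SlotKind} (ha : a.Allowed (s p))
    (hb : b.Allowed (s q)) (hne : p = q → a ≠ b) :
    HostAdj p a q b ↔ ‖slotPos φ q b - slotPos φ p a‖ ≤ 2 := by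
  have hφ' : φ ≤ 1 / 1000 := by nlinarith [mul_nonneg q.cast_nonneg hφ.le]
  obtain rfl | rfl | hpq : q = p ∨ q = p + 1 ∨ p + 2 ≤ q := by omega
  · have hab := hne rfl
    by_cases hadj : a = .spine ↔ b ≠ .spine
    · refine iff_of_true (Or.inr ⟨rfl, hadj⟩) ?_
      rw [slotPos_self_sub]
      by_cases has : a = .spine
      · rw [has]
        simpa [slotOffset] using norm_slotOffset_le hφ hφ' b
      · have hbs : b = .spine := by tauto
        rw [hbs, norm_sub_rev]
        simpa [slotOffset] using norm_slotOffset_le hφ hφ' a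
    · refine iff_of_false (by unfold HostAdj; grind) (not_le.2 ?_)
      exact two_lt_norm_self hφ hq ha hb hab (by grind) (by grind)
  · by_cases hab : a = .spine ∧ b = .spine
    · refine iff_of_true (Or.inl ⟨hab.1, hab.2, Or.inl rfl⟩) ?_
      rw [hab.1, hab.2, slotPos_succ_sub]
      simp [slotOffset, norm_cis]
    · refine iff_of_false (by unfold HostAdj; grind) (not_le.2 ?_)
      exact two_lt_norm_succ (hs p) hφ hq ha hb hab
  · refine iff_of_false (by unfold HostAdj; grind) (not_le.2 ?_)
    by_cases h : q = p + 2 ∧ a = .right ∧ b = .left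
    · obtain ⟨rfl, rfl, rfl⟩ := h
      exact two_lt_norm_left_sub_right hφ hφ'
    · exact two_lt_norm_of_far hφ hpq hq (by intros; by_contra; exact h ⟨by omega, ‹_›, ‹_›⟩)

end Placement

/-- The first `N + 1` positions of the host caterpillar have a unit disk representation with
monotone backbone, whenever no two consecutive positions carry three leaves. -/
theorem exists_host_placement {s : ℕ → Prop} (hs : ∀ p, ¬ (s p ∧ s (p + 1))) (N : ℕ) :
    ∃ pos : ℕ → SlotKind → ℂ,
      (∀ p q a b, p ≤ N → q ≤ N → a.Allowed (s p) → b.Allowed (s q) → (p = q → a ≠ b) →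
        (HostAdj p a q b ↔ dist (pos p a) (pos q b) ≤ 2)) ∧
      ∀ p q, p < q → q ≤ N → (pos p .spine).re < (pos q .spine).re := by
  obtain ⟨φ, hφ, hN⟩ : ∃ φ : ℝ, 0 < φ ∧ ∀ q ≤ N, ((q : ℝ) + 1) * φ ≤ 1 / 1000 := by
    refine ⟨1 / 1000 / (N + 1), by positivity, fun q hq ↦ ?_⟩
    have : (q : ℝ) ≤ N := by exact_mod_cast hq
    rw [mul_div_left_comm]
    exact mul_le_of_le_one_right (by norm_num) ((div_le_one (by positivity)).2 (by linarith))
  refine ⟨slotPos φ, fun p q a b hp hq ha hb hne ↦ ?_, fun p q hpq hq ↦ ?_⟩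
  · rcases le_total p q with hpq | hpq
    · rw [dist_comm, dist_eq_norm]
      exact hostAdj_iff_norm_le_of_le hs hφ hpq (hN q hq) ha hb hne
    · rw [dist_eq_norm, HostAdj.comm]
      exact hostAdj_iff_norm_le_of_le hs hφ hpq (hN p hp) hb ha (fun h ↦ (hne h.symm).symm)
  · have h := (spinePos_mono_re hφ hpq.le (hN q hq)).1
    have hpq' : (p : ℝ) < q := by exact_mod_cast hpq
    simp only [slotPos, slotOffset, add_zero]
    rw [Complex.sub_re] at h
    linarith

end

/-- The host positions available to the leaves of the `i`-th of `m` backbone vertices; the first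
and the last backbone vertex may also use the neighbouring backbone positions. -/
def leafSlots (m : ℕ) (five : Prop) [Decidable five] (i : ℕ) : Finset (ℕ × SlotKind) :=
  (if five then {(i + 1, .down), (i + 1, .left), (i + 1, .right)}
    else {(i + 1, .down), (i + 1, .top)}) ∪
  ((if i = 0 then {(0, .spine)} else ∅) ∪ (if i + 1 = m then {(m + 1, .spine)} else ∅))

lemma card_leafSlots (m : ℕ) (five : Prop) [Decidable five] (i : ℕ) :
    (leafSlots m five i).card = (if five then 3 else 2) +
      ((if i = 0 then 1 else 0) + (if i + 1 = m then 1 else 0)) := by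
  unfold leafSlots
  rw [Finset.card_union_of_disjoint, Finset.card_union_of_disjoint]
  · split_ifs <;> simp
  · split_ifs <;> simp
  · split_ifs <;> simp

lemma of_mem_leafSlots {m : ℕ} {five : Prop} [Decidable five] {i : ℕ} {x : ℕ × SlotKind}
    (hx : x ∈ leafSlots m five i) :
    (x.1 = i + 1 ∧ x.2 ≠ .spine ∧ x.2.Allowed five) ∨
      (x.2 = .spine ∧ (x.1 = 0 ∧ i = 0 ∨ x.1 = m + 1 ∧ i + 1 = m)) := by
  unfold leafSlots at hx
  obtain ⟨p, a⟩ := x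
  split_ifs at hx <;> simp at hx <;> cases a <;> simp_all [SlotKind.Allowed]

lemma SimpleGraph.eq_or_eq_of_reachable {V : Type*} [Fintype V] {G : SimpleGraph V}
    [DecidableRel G.Adj] {u v w : V} (huv : G.Adj u v) (hu : G.degree u ≤ 1)
    (hv : G.degree v ≤ 1) (h : G.Reachable u w) : w = u ∨ w = v := by
  have key : ∀ {x y z : V}, G.degree x ≤ 1 → G.Adj x y → G.Adj x z → y = z := by
    intro x y z hx hy hz
    rw [← G.card_neighborFinset_eq_degree, Finset.card_le_one] at hx
    exact hx y (by simpa) z (by simpa)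
  rw [SimpleGraph.reachable_iff_reflTransGen] at h
  induction h with
  | refl => exact Or.inl rfl
  | tail _ hab ih =>
    rcases ih with rfl | rfl
    · exact Or.inr (key hu hab huv)
    · exact Or.inl (key hv hab huv.symm)

section Host

variable {V : Type*} [Fintype V] {G : SimpleGraph V} [DecidableRel G.Adj] {m : ℕ}
  (e : {v : V | 2 ≤ G.degree v} ≃ Fin m)

/-- The backbone position `p` of the host caterpillar corresponds to a vertex of degree `5`. -/
def IsFive (p : ℕ) : Prop := ∃ i : Fin m, (i : ℕ) + 1 = p ∧ G.degree (e.symm i).val = 5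

lemma isFive_succ_iff (i : Fin m) : IsFive e (i + 1) ↔ G.degree (e.symm i).val = 5 := by
  constructor
  · rintro ⟨j, hj, h⟩
    rwa [← Fin.ext (Nat.succ_injective hj)]
  · exact fun h ↦ ⟨i, rfl, h⟩

lemma adj_symm_iff
    (hpath : ∀ a b : {v : V | 2 ≤ G.degree v},
      (G.induce {v : V | 2 ≤ G.degree v}).Adj a b ↔
        ((e a : ℕ) + 1 = (e b : ℕ) ∨ (e b : ℕ) + 1 = (e a : ℕ))) (i j : Fin m) :
    G.Adj (e.symm i).val (e.symm j).val ↔ ((i : ℕ) + 1 = j ∨ (j : ℕ) + 1 = i) := by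
  simpa using hpath (e.symm i) (e.symm j)

open Classical in
lemma card_leaves_le (hdeg : ∀ v : V, G.degree v ≤ 5)
    (hpath : ∀ a b : {v : V | 2 ≤ G.degree v},
      (G.induce {v : V | 2 ≤ G.degree v}).Adj a b ↔
        ((e a : ℕ) + 1 = (e b : ℕ) ∨ (e b : ℕ) + 1 = (e a : ℕ))) (i : Fin m) :
    ((G.neighborFinset (e.symm i).val).filter (fun u ↦ ¬ 2 ≤ G.degree u)).card ≤
      (leafSlots m (IsFive e (i + 1)) i).card := by
  have hcard := Finset.card_filter_add_card_filter_not (s := G.neighborFinset (e.symm i).val)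
    (fun u ↦ 2 ≤ G.degree u)
  rw [SimpleGraph.card_neighborFinset_eq_degree] at hcard
  have hspine : (if (i : ℕ) = 0 then 0 else 1) + (if (i : ℕ) + 1 = m then 0 else 1) ≤
      ((G.neighborFinset (e.symm i).val).filter (fun u ↦ 2 ≤ G.degree u)).card := by
    have hle : (Finset.univ.filter (fun j : Fin m ↦ (i : ℕ) + 1 = j ∨ (j : ℕ) + 1 = i)).card ≤
        ((G.neighborFinset (e.symm i).val).filter (fun u ↦ 2 ≤ G.degree u)).card := by
      refine Finset.card_le_card_of_injOn (fun j ↦ (e.symm j).val) (fun j hj ↦ ?_)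
        (fun j _ k _ h ↦ e.symm.injective (Subtype.ext h))
      rw [Finset.mem_coe, Finset.mem_filter] at hj
      rw [Finset.mem_coe, Finset.mem_filter, SimpleGraph.mem_neighborFinset]
      exact ⟨(adj_symm_iff e hpath i j).2 hj.2, (e.symm j).2⟩
    refine le_trans ?_ hle
    by_cases h₀ : (i : ℕ) = 0 <;> by_cases h₁ : (i : ℕ) + 1 = m
    · rw [if_pos h₀, if_pos h₁]
      exact Nat.zero_le _
    · rw [if_pos h₀, if_neg h₁]
      exact Finset.card_pos.2 ⟨⟨i + 1, by omega⟩,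
        Finset.mem_filter.2 ⟨Finset.mem_univ _, Or.inl rfl⟩⟩
    · rw [if_neg h₀, if_pos h₁]
      exact Finset.card_pos.2 ⟨⟨i - 1, by omega⟩,
        Finset.mem_filter.2 ⟨Finset.mem_univ _, Or.inr (by simp only; omega)⟩⟩
    · rw [if_neg h₀, if_neg h₁]
      exact Finset.one_lt_card.2 ⟨⟨i + 1, by omega⟩,
        Finset.mem_filter.2 ⟨Finset.mem_univ _, Or.inl rfl⟩, ⟨i - 1, by omega⟩,
        Finset.mem_filter.2 ⟨Finset.mem_univ _, Or.inr (by simp only; omega)⟩,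
        by rw [Ne, Fin.ext_iff]; simp only; omega⟩
  rw [card_leafSlots]
  have h5 := hdeg (e.symm i).val
  rw [isFive_succ_iff]
  split_ifs at hspine ⊢ <;> omega

open Classical in
lemma exists_leaf_assignment (hdeg : ∀ v : V, G.degree v ≤ 5)
    (hpath : ∀ a b : {v : V | 2 ≤ G.degree v},
      (G.induce {v : V | 2 ≤ G.degree v}).Adj a b ↔
        ((e a : ℕ) + 1 = (e b : ℕ) ∨ (e b : ℕ) + 1 = (e a : ℕ))) (i : Fin m) :
    ∃ g : V → ℕ × SlotKind,
      (∀ u, G.Adj (e.symm i).val u → ¬ 2 ≤ G.degree u →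
        g u ∈ leafSlots m (IsFive e (i + 1)) i) ∧
      ∀ u v, G.Adj (e.symm i).val u → ¬ 2 ≤ G.degree u → G.Adj (e.symm i).val v →
        ¬ 2 ≤ G.degree v → g u = g v → u = v := by
  have h := card_leaves_le e hdeg hpath i
  rw [← Fintype.card_coe, ← Fintype.card_coe] at h
  obtain ⟨g⟩ := Function.Embedding.nonempty_of_card_le h
  have hmem : ∀ {u}, G.Adj (e.symm i).val u → ¬ 2 ≤ G.degree u →
      u ∈ (G.neighborFinset (e.symm i).val).filter (fun u ↦ ¬ 2 ≤ G.degree u) := by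
    intro u h₁ h₂
    exact Finset.mem_filter.2 ⟨(SimpleGraph.mem_neighborFinset ..).2 h₁, h₂⟩
  refine ⟨fun u ↦ if hu : u ∈ (G.neighborFinset (e.symm i).val).filter
    (fun u ↦ ¬ 2 ≤ G.degree u) then (g ⟨u, hu⟩).val else (0, .spine), ?_, ?_⟩
  · intro u h₁ h₂
    simp only [dif_pos (hmem h₁ h₂)]
    exact (g _).2
  · intro u v h₁ h₂ h₃ h₄ huv
    simp only [dif_pos (hmem h₁ h₂), dif_pos (hmem h₃ h₄)] at huv
    exact congrArg Subtype.val (g.injective (Subtype.ext huv))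

lemma exists_host_embedding (hconn : G.Connected) (hdeg : ∀ v : V, G.degree v ≤ 5)
    (hpath : ∀ a b : {v : V | 2 ≤ G.degree v},
      (G.induce {v : V | 2 ≤ G.degree v}).Adj a b ↔
        ((e a : ℕ) + 1 = (e b : ℕ) ∨ (e b : ℕ) + 1 = (e a : ℕ))) (hm : 0 < m) :
    ∃ f : V → ℕ × SlotKind, Function.Injective f ∧
      (∀ v, (f v).1 ≤ m + 1 ∧ (f v).2.Allowed (IsFive e (f v).1)) ∧
      (∀ u v, G.Adj u v ↔ HostAdj (f u).1 (f u).2 (f v).1 (f v).2) ∧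
      ∀ i : Fin m, f (e.symm i).val = ((i : ℕ) + 1, SlotKind.spine) := by
  classical
  choose g hg hginj using exists_leaf_assignment e hdeg hpath
  have hparent : ∀ u, ¬ 2 ≤ G.degree u → ∃ i : Fin m, ∀ w, G.Adj w u ↔ w = (e.symm i).val := by
    intro u hu
    have hb : 2 ≤ G.degree (e.symm ⟨0, hm⟩).val := (e.symm ⟨0, hm⟩).2
    have hne : u ≠ (e.symm ⟨0, hm⟩).val := by rintro rfl; exact hu hb
    have : Nontrivial V := ⟨u, _, hne⟩
    have hpos : 0 < G.degree u := hconn.preconnected.degree_pos_of_nontrivial u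
    obtain ⟨v, hv⟩ := Finset.card_eq_one.1 (show (G.neighborFinset u).card = 1 by
      rw [SimpleGraph.card_neighborFinset_eq_degree]; omega)
    have hv' : ∀ w, G.Adj w u ↔ w = v := by
      intro w
      rw [SimpleGraph.adj_comm, ← SimpleGraph.mem_neighborFinset, hv, Finset.mem_singleton]
    have hvdeg : 2 ≤ G.degree v := by
      by_contra hcon
      rcases SimpleGraph.eq_or_eq_of_reachable ((hv' v).2 rfl).symm (by omega) (by omega)
        (hconn.preconnected u (e.symm ⟨0, hm⟩).val) with h | h
      · exact hne h.symm
      · rw [h] at hb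
        exact hcon hb
    exact ⟨e ⟨v, hvdeg⟩, fun w ↦ by rw [hv', Equiv.symm_apply_apply]⟩
  have hclass : ∀ v, (∃ i : Fin m, v = (e.symm i).val) ∨ ¬ 2 ≤ G.degree v := by
    intro v
    by_cases hv : 2 ≤ G.degree v
    · exact Or.inl ⟨e ⟨v, hv⟩, by rw [Equiv.symm_apply_apply]⟩
    · exact Or.inr hv
  choose par hpar using hparent
  obtain ⟨f, hfs, hfl⟩ : ∃ f : V → ℕ × SlotKind,
      (∀ i : Fin m, f (e.symm i).val = ((i : ℕ) + 1, SlotKind.spine)) ∧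
      ∀ u (hu : ¬ 2 ≤ G.degree u), f u = g (par u hu) u := by
    refine ⟨fun u ↦ if hu : 2 ≤ G.degree u then ((e ⟨u, hu⟩ : ℕ) + 1, SlotKind.spine)
      else g (par u hu) u, fun i ↦ ?_, fun u hu ↦ dif_neg hu⟩
    have hi : 2 ≤ G.degree (e.symm i).val := (e.symm i).2
    simp only [dif_pos hi, Subtype.coe_eta, Equiv.apply_symm_apply]
  have hmem : ∀ u (hu : ¬ 2 ≤ G.degree u),
      f u ∈ leafSlots m (IsFive e (par u hu + 1)) (par u hu) := by
    intro u hu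
    rw [hfl u hu]
    exact hg _ u ((hpar u hu _).2 rfl) hu
  have hleaf : ∀ u (i j : Fin m) (hu : ¬ 2 ≤ G.degree u), par u hu = i →
      (HostAdj (f u).1 (f u).2 (j + 1) .spine ↔ j = i) ∧ f u ≠ ((j : ℕ) + 1, SlotKind.spine) := by
    rintro u _ j hu rfl
    have hi := (par u hu).2
    have hj := j.2
    rw [Ne, Prod.ext_iff, Fin.ext_iff]
    unfold HostAdj
    rcases of_mem_leafSlots (hmem u hu) with ⟨h₁, h₂, -⟩ | ⟨h₁, h₂⟩
    · simp only [h₁, h₂]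
      simp
      omega
    · simp only [h₁]
      simp
      omega
  have hspine : ∀ i j : Fin m, G.Adj (e.symm i).val (e.symm j).val ↔
      HostAdj (i + 1) .spine (j + 1) .spine := by
    intro i j
    rw [adj_symm_iff e hpath]
    unfold HostAdj
    simp
  refine ⟨f, ?_, ?_, ?_, hfs⟩
  · intro u v huv
    rcases hclass u with ⟨i, rfl⟩ | hu <;> rcases hclass v with ⟨j, rfl⟩ | hv
    · rw [hfs, hfs, Prod.ext_iff] at huv
      rw [Fin.ext (Nat.succ_injective huv.1)]
    · exact absurd (huv.symm.trans (hfs i)) (hleaf v _ i hv rfl).2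
    · exact absurd (huv.trans (hfs j)) (hleaf u _ j hu rfl).2
    · have hp : par u hu = par v hv := by
        have h₁ := of_mem_leafSlots (hmem u hu)
        have h₂ := of_mem_leafSlots (hmem v hv)
        rw [huv] at h₁
        rw [Fin.ext_iff]
        have := (par u hu).2
        have := (par v hv).2
        grind
      rw [hfl u hu, hfl v hv, ← hp] at huv
      refine hginj _ u v ((hpar u hu _).2 rfl) hu ?_ hv huv
      rw [hp]
      exact (hpar v hv _).2 rfl
  · intro v
    rcases hclass v with ⟨i, rfl⟩ | hv
    · rw [hfs]
      exact ⟨by have := i.2; simp only; omega, trivial⟩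
    · have hi := (par v hv).2
      rcases of_mem_leafSlots (hmem v hv) with ⟨h₁, h₂, h₃⟩ | ⟨h₁, h₂⟩
      · rw [h₁]
        exact ⟨by omega, h₃⟩
      · rw [h₁]
        exact ⟨by omega, trivial⟩
  · intro u v
    rcases hclass u with ⟨i, rfl⟩ | hu <;> rcases hclass v with ⟨j, rfl⟩ | hv
    · rw [hfs, hfs, hspine]
    · rw [hpar v hv, hfs, HostAdj.comm, (hleaf v _ i hv rfl).1]
      exact ⟨fun h ↦ e.symm.injective (Subtype.ext h), fun h ↦ by rw [h]⟩
    · rw [SimpleGraph.adj_comm, hpar u hu, hfs, (hleaf u _ j hu rfl).1]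
      exact ⟨fun h ↦ e.symm.injective (Subtype.ext h), fun h ↦ by rw [h]⟩
    · refine iff_of_false (fun h ↦ ?_) ?_
      · rw [hpar v hv] at h
        exact hu (h ▸ (e.symm (par v hv)).2)
      · have h₁ := of_mem_leafSlots (hmem u hu)
        have h₂ := of_mem_leafSlots (hmem v hv)
        have := (par u hu).2
        have := (par v hv).2
        unfold HostAdj
        grind

end Host

/-- A caterpillar with maximum degree at most 5 and no two adjacent degree-5 vertices
admits a unit disk intersection representation in which the x-coordinates of the
backbone vertices `v₁, …, v_m` (in backbone order) are strictly increasing. -/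
theorem caterpillar_UDR_strictMono_backbone
    {V : Type*} [Fintype V] (G : SimpleGraph V) [DecidableRel G.Adj]
    (hcat : G.IsTree)
    (hdeg : ∀ v : V, G.degree v ≤ 5)
    (hno55 : ∀ u v : V, G.Adj u v → ¬ (G.degree u = 5 ∧ G.degree v = 5))
    (m : ℕ) (e : {v : V | 2 ≤ G.degree v} ≃ Fin m)
    (hpath : ∀ a b : {v : V | 2 ≤ G.degree v},
      (G.induce {v : V | 2 ≤ G.degree v}).Adj a b ↔
        ((e a : ℕ) + 1 = (e b : ℕ) ∨ (e b : ℕ) + 1 = (e a : ℕ))) :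
    ∃ d : V → EuclideanSpace ℝ (Fin 2), IsUDR G d ∧
      StrictMono (fun i : Fin m => d ((e.symm i).val) 0) := by
  have hconn := hcat.connected
  obtain rfl | hm := m.eq_zero_or_pos
  · refine ⟨fun _ ↦ 0, fun u v huv ↦ iff_of_true ?_ (by simp), fun i ↦ i.elim0⟩
    have hle : ∀ w, G.degree w ≤ 1 := fun w ↦ by
      by_contra h
      exact (e ⟨w, show 2 ≤ G.degree w by omega⟩).elim0
    have : Nontrivial V := ⟨u, v, huv⟩
    obtain ⟨w, hw⟩ := (G.degree_pos_iff_exists_adj u).1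
      (hconn.preconnected.degree_pos_of_nontrivial u)
    rcases SimpleGraph.eq_or_eq_of_reachable hw (hle u) (hle w)
      (hconn.preconnected u v) with rfl | rfl
    · exact absurd rfl huv
    · exact hw
  · have hs : ∀ p, ¬ (IsFive e p ∧ IsFive e (p + 1)) := by
      rintro p ⟨⟨i, hi, hi5⟩, j, hj, hj5⟩
      exact hno55 _ _ ((adj_symm_iff e hpath i j).2 (Or.inl (by omega))) ⟨hi5, hj5⟩
    obtain ⟨pos, hpos, hmono⟩ := exists_host_placement hs (m + 1)
    obtain ⟨f, hinj, hf, hadj, hspine⟩ := exists_host_embedding e hconn hdeg hpath hm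
    let x (v : V) : ℂ := pos (f v).1 (f v).2
    refine ⟨fun v ↦ !₂[(x v).re, (x v).im], fun u v huv ↦ ?_, fun i j hij ↦ ?_⟩
    · rw [hadj, hpos _ _ _ _ (hf u).1 (hf v).1 (hf u).2 (hf v).2
        (fun h₁ h₂ ↦ huv (hinj (Prod.ext h₁ h₂))), Complex.dist_eq_re_im,
        EuclideanSpace.dist_eq]
      simp [x, Real.dist_eq, sq_abs]
    · have := hmono (i + 1) (j + 1) (by simpa using hij) (by have := j.2; omega)
      simpa [x, hspine] using this
end
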